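/- arXiv:2503.14176 — 3 statements merged into one kernel-verified Lean document; each statement's English description precedes it below -/
import Mathlib

section
/- Let a, b > 0 be fixed real numbers. Then for every real H ≥ 1, the sum Σ₁(H; a, b) = Σ over quadruples of positive integers (h₁, h₂, r₁, r₂) with h₁ > H and h₁^a r₁^b = h₂^a r₂^b of (h₁h₂)^{−(a+2b)/(2(a+b))} (r₁r₂)^{−(2a+b)/(2(a+b))} satisfies Σ₁(H; a, b) ≪ H^{−b/(2(a+b))} log²(2H), where the implied constant depends only on a and b. -/
open Real

open Classical in
/-- `Σ₁(H; a, b)`: the sum over quadruples `(h₁, h₂, r₁, r₂)` of positive integers with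
`h₁ > H` and `h₁^a r₁^b = h₂^a r₂^b` of the weights
`(h₁h₂)^{-(a+2b)/(2(a+b))} (r₁r₂)^{-(2a+b)/(2(a+b))}`. -/
noncomputable def Sigma1 (H a b : ℝ) : ℝ :=
  ∑' q : ℕ+ × ℕ+ × ℕ+ × ℕ+,
    if H < (q.1 : ℝ) ∧
        (q.1 : ℝ) ^ a * (q.2.2.1 : ℝ) ^ b = (q.2.1 : ℝ) ^ a * (q.2.2.2 : ℝ) ^ b then
      ((q.1 : ℝ) * (q.2.1 : ℝ)) ^ (-(a + 2 * b) / (2 * (a + b))) *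
        ((q.2.2.1 : ℝ) * (q.2.2.2 : ℝ)) ^ (-(2 * a + b) / (2 * (a + b)))
    else 0

namespace SigmaAux

/-- Two pairs with the same ratio and the same gcd coincide. -/
lemma eq_of_ratio {r₁ r₂ s₁ s₂ : ℕ} (h1 : 0 < r₁)
    (hr : r₁ * s₂ = s₁ * r₂) (hg : r₁.gcd r₂ = s₁.gcd s₂) : r₁ = s₁ ∧ r₂ = s₂ := by
  have hpos : 0 < r₁.gcd r₂ := Nat.gcd_pos_of_pos_left _ h1
  have e1 : r₁ * s₁.gcd s₂ = s₁ * r₁.gcd r₂ := by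
    rw [← Nat.gcd_mul_left, ← Nat.gcd_mul_left, hr, Nat.mul_comm r₁ s₁]
  have e : r₁ = s₁ := by
    rw [← hg] at e1
    exact Nat.eq_of_mul_eq_mul_right hpos e1
  subst e
  exact ⟨rfl, (Nat.eq_of_mul_eq_mul_left h1 hr).symm⟩

/-- The diagonal set determines one ratio from the other. -/
lemma ratio_of_diag {a b h₁ h₂ r₁ r₂ s₁ s₂ : ℝ} (hb : 0 < b)
    (p1 : 0 < h₁) (p2 : 0 < h₂) (q1 : 0 < r₁) (q2 : 0 < r₂) (t1 : 0 < s₁) (t2 : 0 < s₂)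
    (e1 : h₁ ^ a * r₁ ^ b = h₂ ^ a * r₂ ^ b) (e2 : h₁ ^ a * s₁ ^ b = h₂ ^ a * s₂ ^ b) :
    r₁ * s₂ = s₁ * r₂ := by
  have A : 0 < h₁ ^ a := rpow_pos_of_pos p1 a
  have B : 0 < h₂ ^ a := rpow_pos_of_pos p2 a
  have key : (r₁ * s₂) ^ b = (s₁ * r₂) ^ b := by
    rw [mul_rpow q1.le t2.le, mul_rpow t1.le q2.le]
    have : (h₁ ^ a * h₂ ^ a) * (r₁ ^ b * s₂ ^ b) = (h₁ ^ a * h₂ ^ a) * (s₁ ^ b * r₂ ^ b) := by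
      calc _ = (h₁ ^ a * r₁ ^ b) * (h₂ ^ a * s₂ ^ b) := by ring
        _ = (h₂ ^ a * r₂ ^ b) * (h₁ ^ a * s₁ ^ b) := by rw [e1, e2]
        _ = _ := by ring
    exact mul_left_cancel₀ (mul_pos A B).ne' this
  exact (Real.rpow_left_inj (by positivity) (by positivity) hb.ne').1 key

/-- The diagonal set. -/
def D (a b : ℝ) : Set (ℕ+ × ℕ+ × ℕ+ × ℕ+) :=
  {q | (q.1 : ℝ) ^ a * (q.2.2.1 : ℝ) ^ b = (q.2.1 : ℝ) ^ a * (q.2.2.2 : ℝ) ^ b}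

/-- First parametrisation. -/
def phi1 (q : ℕ+ × ℕ+ × ℕ+ × ℕ+) : ℕ × ℕ × ℕ × ℕ :=
  (Nat.gcd q.1 q.2.1, Nat.gcd q.2.2.1 q.2.2.2,
    (q.1 : ℕ) / Nat.gcd q.1 q.2.1, (q.2.1 : ℕ) / Nat.gcd q.1 q.2.1)

/-- Second parametrisation. -/
def phi2 (q : ℕ+ × ℕ+ × ℕ+ × ℕ+) : ℕ × ℕ × ℕ × ℕ :=
  (Nat.gcd q.1 q.2.1, Nat.gcd q.2.2.1 q.2.2.2,
    (q.2.2.1 : ℕ) / Nat.gcd q.2.2.1 q.2.2.2, (q.2.2.2 : ℕ) / Nat.gcd q.2.2.1 q.2.2.2)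

lemma eq_of_div {x y g : ℕ} (hx : g ∣ x) (hy : g ∣ y) (h : x / g = y / g) : x = y := by
  rw [← Nat.div_mul_cancel hx, h, Nat.div_mul_cancel hy]

lemma phi1_inj (a b : ℝ) (hb : 0 < b) :
    Function.Injective (fun q : D a b => phi1 q) := by
  rintro ⟨⟨h₁, h₂, r₁, r₂⟩, hq⟩ ⟨⟨k₁, k₂, s₁, s₂⟩, hq'⟩ h
  simp only [phi1, Prod.mk.injEq] at h
  simp only [D, Set.mem_ofPred_eq] at hq hq'
  obtain ⟨g1, g2, e1, e2⟩ := h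
  rw [← g1] at e1 e2
  have i1 : h₁ = k₁ := PNat.coe_injective
    (eq_of_div (Nat.gcd_dvd_left _ _) (g1 ▸ Nat.gcd_dvd_left _ _) e1)
  have i2 : h₂ = k₂ := PNat.coe_injective
    (eq_of_div (Nat.gcd_dvd_right _ _) (g1 ▸ Nat.gcd_dvd_right _ _) e2)
  subst i1 i2
  have hr := ratio_of_diag hb (by positivity) (by positivity) (by positivity) (by positivity)
    (by positivity) (by positivity) hq hq'
  obtain ⟨j1, j2⟩ := eq_of_ratio r₁.pos (by exact_mod_cast hr) g2
  have l1 := PNat.coe_injective j1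
  have l2 := PNat.coe_injective j2
  subst l1 l2
  rfl

lemma phi2_inj (a b : ℝ) (ha : 0 < a) :
    Function.Injective (fun q : D a b => phi2 q) := by
  rintro ⟨⟨h₁, h₂, r₁, r₂⟩, hq⟩ ⟨⟨k₁, k₂, s₁, s₂⟩, hq'⟩ h
  simp only [phi2, Prod.mk.injEq] at h
  simp only [D, Set.mem_ofPred_eq] at hq hq'
  obtain ⟨g1, g2, e1, e2⟩ := h
  rw [← g2] at e1 e2
  have i1 : r₁ = s₁ := PNat.coe_injective
    (eq_of_div (Nat.gcd_dvd_left _ _) (g2 ▸ Nat.gcd_dvd_left _ _) e1)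
  have i2 : r₂ = s₂ := PNat.coe_injective
    (eq_of_div (Nat.gcd_dvd_right _ _) (g2 ▸ Nat.gcd_dvd_right _ _) e2)
  subst i1 i2
  rw [mul_comm, mul_comm ((h₂ : ℝ) ^ a)] at hq
  rw [mul_comm, mul_comm ((k₂ : ℝ) ^ a)] at hq'
  have hr := ratio_of_diag ha (by positivity) (by positivity) (by positivity) (by positivity)
    (by positivity) (by positivity) hq hq'
  obtain ⟨j1, j2⟩ := eq_of_ratio h₁.pos (by exact_mod_cast hr) g1
  have l1 := PNat.coe_injective j1
  have l2 := PNat.coe_injective j2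
  subst l1 l2
  rfl

/-- The majorant. -/
noncomputable def G (θ : ℝ) (x : ℕ × ℕ × ℕ × ℕ) : ℝ :=
  (x.1 : ℝ) ^ (-(1 + θ)) * ((x.2.1 : ℝ) ^ (-(2 - 2 * θ)) *
    ((x.2.2.1 : ℝ) ^ (-(3 / 2 - θ)) * (x.2.2.2 : ℝ) ^ (-(3 / 2 - θ))))

lemma G_nonneg (θ : ℝ) (x : ℕ × ℕ × ℕ × ℕ) : 0 ≤ G θ x := by
  unfold G; positivity

lemma G_summable (θ : ℝ) (h0 : 0 < θ) (h1 : θ < 1 / 2) : Summable (G θ) := by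
  have s1 : Summable (fun n : ℕ => (n : ℝ) ^ (-(1 + θ))) :=
    Real.summable_nat_rpow.2 (by linarith)
  have s2 : Summable (fun n : ℕ => (n : ℝ) ^ (-(2 - 2 * θ))) :=
    Real.summable_nat_rpow.2 (by linarith)
  have s3 : Summable (fun n : ℕ => (n : ℝ) ^ (-(3 / 2 - θ))) :=
    Real.summable_nat_rpow.2 (by linarith)
  have s4 := s3.mul_of_nonneg s3 (fun _ => by positivity) (fun _ => by positivity)
  have s5 := s2.mul_of_nonneg s4 (fun _ => by positivity) (fun _ => by simp only [Pi.zero_apply]; positivity)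
  exact s1.mul_of_nonneg s5 (fun _ => by positivity) (fun _ => by simp only [Pi.zero_apply]; positivity)

lemma min_bound {θ A B : ℝ} (h1 : θ < 1 / 2) (hA : 0 < A) (hB : 0 < B) :
    A ^ (-(1 / 2 : ℝ)) * B ^ (-(1 - θ)) ≤ A ^ (-(3 / 2 - θ)) + B ^ (-(3 / 2 - θ)) := by
  have pA : 0 < A ^ (-(3 / 2 - θ)) := rpow_pos_of_pos hA _
  have pB : 0 < B ^ (-(3 / 2 - θ)) := rpow_pos_of_pos hB _
  rcases le_total A B with h | h
  · have : B ^ (-(1 - θ)) ≤ A ^ (-(1 - θ)) := rpow_le_rpow_of_nonpos hA h (by linarith)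
    calc _ ≤ A ^ (-(1 / 2 : ℝ)) * A ^ (-(1 - θ)) := by gcongr
      _ = A ^ (-(3 / 2 - θ)) := by rw [← rpow_add hA]; congr 1; ring
      _ ≤ _ := by linarith
  · have : A ^ (-(1 / 2 : ℝ)) ≤ B ^ (-(1 / 2 : ℝ)) := rpow_le_rpow_of_nonpos hB h (by norm_num)
    calc _ ≤ B ^ (-(1 / 2 : ℝ)) * B ^ (-(1 - θ)) := by gcongr
      _ = B ^ (-(3 / 2 - θ)) := by rw [← rpow_add hB]; congr 1; ring
      _ ≤ _ := by linarith

lemma core {θ H k m u v s t : ℝ} (h0 : 0 < θ) (h1 : θ < 1 / 2) (hH : 0 < H)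
    (hk : 0 < k) (hm : 0 < m) (hu : 0 < u) (hv : 1 ≤ v) (hs : 0 < s) (ht : 0 < t)
    (hHk : H < k * u) :
    ((k * u) * (k * v)) ^ (-(1 / 2 + θ)) * ((m * s) * (m * t)) ^ (-(1 - θ)) ≤
      H ^ (-θ) * (k ^ (-(1 + θ)) * (m ^ (-(2 - 2 * θ)) * (u ^ (-(3 / 2 - θ)) * v ^ (-(3 / 2 - θ))))
      + k ^ (-(1 + θ)) * (m ^ (-(2 - 2 * θ)) * (s ^ (-(3 / 2 - θ)) * t ^ (-(3 / 2 - θ))))) := by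
  have hv0 : 0 < v := by linarith
  have r1 : (k * u) ^ (-θ) ≤ H ^ (-θ) := rpow_le_rpow_of_nonpos hH hHk.le (by linarith)
  have r2 : v ^ (-(1 / 2 + θ)) ≤ v ^ (-(1 / 2 : ℝ)) :=
    rpow_le_rpow_of_exponent_le hv (by linarith)
  have r3 := min_bound h1 (mul_pos hu hv0) (mul_pos hs ht)
  have e1 : ((k * u) * (k * v)) ^ (-(1 / 2 + θ)) =
      (k * u) ^ (-θ) * (k ^ (-(1 + θ)) * (u ^ (-(1 / 2 : ℝ)) * v ^ (-(1 / 2 + θ)))) := by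
    rw [mul_rpow (by positivity) (by positivity), mul_rpow hk.le hu.le, mul_rpow hk.le hv0.le,
      mul_rpow hk.le hu.le]
    have a1 : k ^ (-(1 / 2 + θ)) * k ^ (-(1 / 2 + θ)) = k ^ (-θ) * k ^ (-(1 + θ)) := by
      rw [← rpow_add hk, ← rpow_add hk]; congr 1; ring
    have a2 : u ^ (-(1 / 2 + θ)) = u ^ (-θ) * u ^ (-(1 / 2 : ℝ)) := by
      rw [← rpow_add hu]; congr 1; ring
    rw [a2]
    linear_combination (u ^ (-θ) * u ^ (-(1 / 2 : ℝ)) * v ^ (-(1 / 2 + θ))) * a1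
  have e2 : ((m * s) * (m * t)) ^ (-(1 - θ)) = m ^ (-(2 - 2 * θ)) * (s * t) ^ (-(1 - θ)) := by
    have : (m * s) * (m * t) = (m * m) * (s * t) := by ring
    rw [this, mul_rpow (by positivity) (by positivity), mul_rpow hm.le hm.le, ← rpow_add hm]
    congr 2; ring
  rw [e1, e2]
  calc _ ≤ H ^ (-θ) * (k ^ (-(1 + θ)) * (u ^ (-(1 / 2 : ℝ)) * v ^ (-(1 / 2 : ℝ)))) *
        (m ^ (-(2 - 2 * θ)) * (s * t) ^ (-(1 - θ))) := by gcongr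
    _ = H ^ (-θ) * (k ^ (-(1 + θ)) * (m ^ (-(2 - 2 * θ)) *
        ((u * v) ^ (-(1 / 2 : ℝ)) * (s * t) ^ (-(1 - θ))))) := by
      rw [mul_rpow hu.le hv0.le]; ring
    _ ≤ H ^ (-θ) * (k ^ (-(1 + θ)) * (m ^ (-(2 - 2 * θ)) *
        ((u * v) ^ (-(3 / 2 - θ)) + (s * t) ^ (-(3 / 2 - θ))))) := by gcongr
    _ = _ := by
      rw [mul_rpow hu.le hv0.le, mul_rpow hs.le ht.le]; ring

lemma gcd_split (x y : ℕ+) : ∃ g u v : ℕ, g = Nat.gcd x y ∧ 0 < g ∧ 0 < u ∧ 0 < v ∧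
    u = (x : ℕ) / Nat.gcd x y ∧ v = (y : ℕ) / Nat.gcd x y ∧ (x : ℝ) = g * u ∧ (y : ℝ) = g * v := by
  have hg : 0 < Nat.gcd x y := Nat.gcd_pos_of_pos_left _ x.pos
  refine ⟨_, _, _, rfl, hg, ?_, ?_, rfl, rfl, ?_, ?_⟩
  · exact Nat.div_pos (Nat.le_of_dvd x.pos (Nat.gcd_dvd_left _ _)) hg
  · exact Nat.div_pos (Nat.le_of_dvd y.pos (Nat.gcd_dvd_right _ _)) hg
  · exact_mod_cast (Nat.mul_div_cancel' (Nat.gcd_dvd_left (x : ℕ) y)).symm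
  · exact_mod_cast (Nat.mul_div_cancel' (Nat.gcd_dvd_right (x : ℕ) y)).symm

lemma term_bound {θ H : ℝ} (h0 : 0 < θ) (h1 : θ < 1 / 2) (hH : 0 < H)
    (q : ℕ+ × ℕ+ × ℕ+ × ℕ+) (hq : H < (q.1 : ℝ)) :
    ((q.1 : ℝ) * (q.2.1 : ℝ)) ^ (-(1 / 2 + θ)) *
        ((q.2.2.1 : ℝ) * (q.2.2.2 : ℝ)) ^ (-(1 - θ)) ≤
      H ^ (-θ) * (G θ (phi1 q) + G θ (phi2 q)) := by
  obtain ⟨h₁, h₂, r₁, r₂⟩ := q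
  obtain ⟨k, u, v, ek, pk, pu, pv, eu, ev, f1, f2⟩ := gcd_split h₁ h₂
  obtain ⟨m, s, t, em, pm, ps, pt, es, et, f3, f4⟩ := gcd_split r₁ r₂
  simp only [G, phi1, phi2] at hq ⊢
  rw [← eu, ← ev, ← es, ← et, ← ek, ← em, f1, f2, f3, f4]
  rw [f1] at hq
  exact core h0 h1 hH (by exact_mod_cast pk) (by exact_mod_cast pm) (by exact_mod_cast pu)
    (by exact_mod_cast pv) (by exact_mod_cast ps) (by exact_mod_cast pt) hq

end SigmaAux

open SigmaAux in
theorem Sigma1_bound (a b : ℝ) (ha : 0 < a) (hb : 0 < b) :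
    ∃ C > (0 : ℝ), ∀ H : ℝ, 1 ≤ H →
      Sigma1 H a b ≤ C * H ^ (-b / (2 * (a + b))) * (Real.log (2 * H)) ^ 2 := by
  obtain ⟨θ, hθ⟩ : ∃ θ, θ = b / (2 * (a + b)) := ⟨_, rfl⟩
  have h0 : 0 < θ := by rw [hθ]; positivity
  have h1 : θ < 1 / 2 := by rw [hθ, div_lt_div_iff₀ (by positivity) (by norm_num)]; linarith
  have x1 : -(a + 2 * b) / (2 * (a + b)) = -(1 / 2 + θ) := by rw [hθ]; field_simp; ring
  have x2 : -(2 * a + b) / (2 * (a + b)) = -(1 - θ) := by rw [hθ]; field_simp; ring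
  have x3 : -b / (2 * (a + b)) = -θ := by rw [hθ]; ring
  let F : ℕ+ × ℕ+ × ℕ+ × ℕ+ → ℝ :=
    (D a b).indicator (fun q => G θ (phi1 q) + G θ (phi2 q))
  have hF0 : ∀ q, 0 ≤ F q := fun q => Set.indicator_nonneg
    (fun q _ => add_nonneg (G_nonneg _ _) (G_nonneg _ _)) q
  have hF : Summable F := by
    rw [← summable_subtype_iff_indicator]
    exact ((G_summable θ h0 h1).comp_injective (phi1_inj a b hb)).add
      ((G_summable θ h0 h1).comp_injective (phi2_inj a b ha))
  have hT : 0 ≤ ∑' q, F q := tsum_nonneg hF0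
  have hl2 : 0 < Real.log 2 := Real.log_pos (by norm_num)
  refine ⟨(∑' q, F q + 1) / (Real.log 2) ^ 2, by positivity, fun H hH => ?_⟩
  have hH0 : 0 < H := by linarith
  have hle : Sigma1 H a b ≤ ∑' q, H ^ (-θ) * F q := by
    unfold Sigma1
    rw [x1, x2]
    have hle0 : ∀ q : ℕ+ × ℕ+ × ℕ+ × ℕ+, (if H < (q.1 : ℝ) ∧
        (q.1 : ℝ) ^ a * (q.2.2.1 : ℝ) ^ b = (q.2.1 : ℝ) ^ a * (q.2.2.2 : ℝ) ^ b then
      ((q.1 : ℝ) * (q.2.1 : ℝ)) ^ (-(1 / 2 + θ)) *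
        ((q.2.2.1 : ℝ) * (q.2.2.2 : ℝ)) ^ (-(1 - θ)) else 0) ≤ H ^ (-θ) * F q := by
      intro q
      split_ifs with hc
      · have : F q = G θ (phi1 q) + G θ (phi2 q) :=
          Set.indicator_of_mem (show q ∈ D a b from hc.2) _
        rw [this]
        exact term_bound h0 h1 hH0 q hc.1
      · exact mul_nonneg (by positivity) (hF0 q)
    refine Summable.tsum_le_tsum hle0
      (Summable.of_nonneg_of_le ?_ hle0 (hF.mul_left _)) (hF.mul_left _)
    intro q
    split_ifs
    · positivity
    · exact le_rfl
  rw [tsum_mul_left] at hle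
  have hlog : Real.log 2 ≤ Real.log (2 * H) := Real.log_le_log (by norm_num) (by linarith)
  rw [x3]
  calc Sigma1 H a b ≤ H ^ (-θ) * ∑' q, F q := hle
    _ ≤ H ^ (-θ) * (∑' q, F q + 1) := by gcongr; linarith
    _ = (∑' q, F q + 1) / (Real.log 2) ^ 2 * H ^ (-θ) * (Real.log 2) ^ 2 := by
      field_simp
    _ ≤ _ := by gcongr
end

section
/- Let a, b > 0 be fixed real numbers. Then the four-fold series G_{a,b} = Σ_{h₁=1}^∞ Σ_{h₂=1}^∞ Σ_{r₁=1}^∞ Σ_{r₂=1}^∞, restricted to quadruples with h₁^a r₁^b = h₂^a r₂^b, of (h₁h₂)^{−(a+2b)/(2(a+b))} (r₁r₂)^{−(2a+b)/(2(a+b))} is convergent (the sum of this nonnegative series is finite). -/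
open Real

/-- Primitive solutions. -/
def primS (a b : ℝ) : Set ((ℕ × ℕ) × (ℕ × ℕ)) :=
  {x | 0 < x.1.1 ∧ 0 < x.1.2 ∧ 0 < x.2.1 ∧ 0 < x.2.2 ∧ Nat.Coprime x.1.1 x.1.2 ∧
    Nat.Coprime x.2.1 x.2.2 ∧
    (x.1.1 : ℝ) ^ a * (x.2.1 : ℝ) ^ b = (x.1.2 : ℝ) ^ a * (x.2.2 : ℝ) ^ b}

lemma coprime_cross {p q p' q' : ℕ} (h : Nat.Coprime p q) (h' : Nat.Coprime p' q')
    (e : p * q' = p' * q) : p = p' ∧ q = q' := by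
  have h1 : p ∣ p' := h.dvd_of_dvd_mul_right (Dvd.intro _ e)
  have h2 : p' ∣ p := h'.dvd_of_dvd_mul_right (Dvd.intro _ e.symm)
  have h3 : q ∣ q' := h.symm.dvd_of_dvd_mul_left (Dvd.intro_left _ e.symm)
  have h4 : q' ∣ q := h'.symm.dvd_of_dvd_mul_left (Dvd.intro_left _ e)
  exact ⟨Nat.dvd_antisymm h1 h2, Nat.dvd_antisymm h3 h4⟩

lemma cross_of_cond {a b : ℝ} (hb : 0 < b) {m n p q p' q' : ℕ} (hm : 0 < m) (hn : 0 < n)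
    (e : (m : ℝ) ^ a * (p : ℝ) ^ b = (n : ℝ) ^ a * (q : ℝ) ^ b)
    (e' : (m : ℝ) ^ a * (p' : ℝ) ^ b = (n : ℝ) ^ a * (q' : ℝ) ^ b) :
    p * q' = p' * q := by
  have hM : 0 < (m : ℝ) ^ a := by positivity
  have hN : 0 < (n : ℝ) ^ a := by positivity
  have : ((p : ℝ) * q') ^ b = ((p' : ℝ) * q) ^ b := by
    rw [Real.mul_rpow (by positivity) (by positivity),
      Real.mul_rpow (by positivity) (by positivity)]
    apply mul_left_cancel₀ (mul_pos hM hN).ne'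
    linear_combination ((n : ℝ) ^ a * (q' : ℝ) ^ b) * e - ((n : ℝ) ^ a * (q : ℝ) ^ b) * e'
  have := (Real.rpow_left_inj (by positivity) (by positivity) hb.ne').1 this
  exact_mod_cast this

lemma inj_fst {a b : ℝ} (hb : 0 < b) :
    Function.Injective (fun x : primS a b => x.1.1) := by
  rintro ⟨⟨⟨m, n⟩, ⟨p, q⟩⟩, h1, h2, h3, h4, h5, h6, h7⟩
    ⟨⟨⟨m', n'⟩, ⟨p', q'⟩⟩, k1, k2, k3, k4, k5, k6, k7⟩ h
  simp only [Prod.mk.injEq] at *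
  obtain ⟨rfl, rfl⟩ := h
  obtain ⟨rfl, rfl⟩ := coprime_cross h6 k6 (cross_of_cond hb h1 h2 h7 k7)
  rfl

lemma inj_snd {a b : ℝ} (ha : 0 < a) :
    Function.Injective (fun x : primS a b => x.1.2) := by
  rintro ⟨⟨⟨m, n⟩, ⟨p, q⟩⟩, h1, h2, h3, h4, h5, h6, h7⟩
    ⟨⟨⟨m', n'⟩, ⟨p', q'⟩⟩, k1, k2, k3, k4, k5, k6, k7⟩ h
  simp only [Prod.mk.injEq] at *
  obtain ⟨rfl, rfl⟩ := h
  obtain ⟨rfl, rfl⟩ := coprime_cross h5 k5 (cross_of_cond ha h3 h4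
    (by rw [mul_comm, h7, mul_comm]) (by rw [mul_comm, k7, mul_comm]))
  rfl

lemma summable_pair : Summable (fun x : ℕ × ℕ => ((x.1 : ℝ) * x.2) ^ (-(3 / 2) : ℝ)) := by
  have h : Summable (fun n : ℕ => (n : ℝ) ^ (-(3 / 2) : ℝ)) :=
    Real.summable_nat_rpow.2 (by norm_num)
  refine (h.mul_of_nonneg h (fun n => by positivity) (fun n => by positivity)).congr ?_
  rintro ⟨m, n⟩
  exact (Real.mul_rpow (by positivity) (by positivity)).symm

lemma young {α β u v : ℝ} (hα : 0 < α) (hβ : 0 < β) (h : α + β = 3 / 2) (hu : 0 < u)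
    (hv : 0 < v) : u ^ (-α) * v ^ (-β) ≤ u ^ (-(3 / 2) : ℝ) + v ^ (-(3 / 2) : ℝ) := by
  rcases le_total u v with huv | huv
  · have h1 : v ^ (-β) ≤ u ^ (-β) := Real.rpow_le_rpow_of_nonpos hu huv (by linarith)
    have h2 : u ^ (-(3 / 2) : ℝ) = u ^ (-α) * u ^ (-β) := by
      rw [← Real.rpow_add hu]; congr 1; linarith
    rw [h2]
    have h3 : 0 ≤ v ^ (-(3 / 2) : ℝ) := by positivity
    have := mul_le_mul_of_nonneg_left h1 (by positivity : 0 ≤ u ^ (-α))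
    linarith
  · have h1 : u ^ (-α) ≤ v ^ (-α) := Real.rpow_le_rpow_of_nonpos hv huv (by linarith)
    have h2 : v ^ (-(3 / 2) : ℝ) = v ^ (-α) * v ^ (-β) := by
      rw [← Real.rpow_add hv]; congr 1; linarith
    rw [h2]
    have h3 : 0 ≤ u ^ (-(3 / 2) : ℝ) := by positivity
    have := mul_le_mul_of_nonneg_right h1 (by positivity : 0 ≤ v ^ (-β))
    linarith

/-- The summand on primitive solutions. -/
noncomputable def primG (α β : ℝ) (x : (ℕ × ℕ) × (ℕ × ℕ)) : ℝ :=
  ((x.1.1 : ℝ) * x.1.2) ^ (-α) * ((x.2.1 : ℝ) * x.2.2) ^ (-β)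

lemma summable_prim {a b α β : ℝ} (ha : 0 < a) (hb : 0 < b) (hα : 0 < α) (hβ : 0 < β)
    (h : α + β = 3 / 2) : Summable ((primS a b).indicator (primG α β)) := by
  rw [← summable_subtype_iff_indicator]
  refine Summable.of_nonneg_of_le (fun x => ?_) (fun x => ?_)
    ((summable_pair.comp_injective (inj_fst (a := a) hb)).add
      (summable_pair.comp_injective (inj_snd (b := b) ha)))
  · simp only [Function.comp, primG]; positivity
  · obtain ⟨⟨⟨m, n⟩, ⟨p, q⟩⟩, h1, h2, h3, h4, h5, h6, h7⟩ := x
    simp only at h1 h2 h3 h4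
    exact young hα hβ h (by positivity) (by positivity)

/-- Dividing out the gcds. -/
def gcdMap (q : ℕ+ × ℕ+ × ℕ+ × ℕ+) : (ℕ × ℕ) × ((ℕ × ℕ) × (ℕ × ℕ)) :=
  let g := Nat.gcd q.1 q.2.1
  let k := Nat.gcd q.2.2.1 q.2.2.2
  ((g, k), (((q.1 : ℕ) / g, (q.2.1 : ℕ) / g), ((q.2.2.1 : ℕ) / k, (q.2.2.2 : ℕ) / k)))

lemma gcd_decomp (x y : ℕ+) : ∃ g m n : ℕ, 0 < g ∧ 0 < m ∧ 0 < n ∧ Nat.Coprime m n ∧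
    Nat.gcd x y = g ∧ (x : ℕ) / g = m ∧ (y : ℕ) / g = n ∧ (x : ℕ) = g * m ∧
    (y : ℕ) = g * n := by
  have hg : 0 < Nat.gcd x y := Nat.gcd_pos_of_pos_left _ x.pos
  have hx := Nat.gcd_dvd_left (x : ℕ) y
  have hy := Nat.gcd_dvd_right (x : ℕ) y
  exact ⟨_, _, _, hg, Nat.div_pos (Nat.le_of_dvd x.pos hx) hg,
    Nat.div_pos (Nat.le_of_dvd y.pos hy) hg, Nat.coprime_div_gcd_div_gcd hg, rfl, rfl, rfl,
    (Nat.mul_div_cancel' hx).symm, (Nat.mul_div_cancel' hy).symm⟩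

lemma gcdMap_inj : Function.Injective gcdMap := by
  rintro ⟨x, y, z, w⟩ ⟨x', y', z', w'⟩ h
  obtain ⟨g, m, n, -, -, -, -, e1, e2, e3, e4, e5⟩ := gcd_decomp x y
  obtain ⟨k, p, q, -, -, -, -, f1, f2, f3, f4, f5⟩ := gcd_decomp z w
  obtain ⟨g', m', n', -, -, -, -, e1', e2', e3', e4', e5'⟩ := gcd_decomp x' y'
  obtain ⟨k', p', q', -, -, -, -, f1', f2', f3', f4', f5'⟩ := gcd_decomp z' w'
  simp only [gcdMap, e1, e2, e3, f1, f2, f3, e1', e2', e3', f1', f2', f3', Prod.mk.injEq] at h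
  obtain ⟨⟨rfl, rfl⟩, ⟨rfl, rfl⟩, rfl, rfl⟩ := h
  simp only [Prod.mk.injEq, ← PNat.coe_inj]
  exact ⟨e4.trans e4'.symm, e5.trans e5'.symm, f4.trans f4'.symm, f5.trans f5'.symm⟩

lemma split_rpow {g m n : ℝ} (α : ℝ) (hg : 0 < g) (hm : 0 < m) (hn : 0 < n) :
    ((g * m) * (g * n)) ^ (-α) = g ^ (-(2 * α)) * (m * n) ^ (-α) := by
  rw [show (g * m) * (g * n) = (g * g) * (m * n) by ring,
    Real.mul_rpow (by positivity) (by positivity), Real.mul_rpow hg.le hg.le,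
    ← Real.rpow_add hg]
  congr 2; ring

open Classical in
theorem Gab_summable (a b : ℝ) (ha : 0 < a) (hb : 0 < b) :
    Summable (fun q : ℕ+ × ℕ+ × ℕ+ × ℕ+ =>
      if (q.1 : ℝ) ^ a * (q.2.2.1 : ℝ) ^ b = (q.2.1 : ℝ) ^ a * (q.2.2.2 : ℝ) ^ b then
        ((q.1 : ℝ) * (q.2.1 : ℝ)) ^ (-(a + 2 * b) / (2 * (a + b))) *
          ((q.2.2.1 : ℝ) * (q.2.2.2 : ℝ)) ^ (-(2 * a + b) / (2 * (a + b)))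
      else 0) := by
  obtain ⟨α, hαd⟩ : ∃ α, α = (a + 2 * b) / (2 * (a + b)) := ⟨_, rfl⟩
  obtain ⟨β, hβd⟩ : ∃ β, β = (2 * a + b) / (2 * (a + b)) := ⟨_, rfl⟩
  have hα : 1 / 2 < α := by
    rw [hαd, div_lt_div_iff₀ (by positivity) (by positivity)]; linarith
  have hβ : 1 / 2 < β := by
    rw [hβd, div_lt_div_iff₀ (by positivity) (by positivity)]; linarith
  have hs : α + β = 3 / 2 := by
    rw [hαd, hβd]; field_simp; ring
  rw [neg_div, neg_div, ← hαd, ← hβd]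
  have H1 : Summable (fun n : ℕ => (n : ℝ) ^ (-(2 * α))) :=
    Real.summable_nat_rpow.2 (by linarith)
  have H2 : Summable (fun n : ℕ => (n : ℝ) ^ (-(2 * β))) :=
    Real.summable_nat_rpow.2 (by linarith)
  have H3 := summable_prim (α := α) (β := β) ha hb (by linarith) (by linarith) hs
  have hG : ∀ x, 0 ≤ (primS a b).indicator (primG α β) x := fun x =>
    Set.indicator_nonneg (fun x _ => by unfold primG; positivity) x
  have H12 := H1.mul_of_nonneg H2 (fun n => by positivity) (fun n => by positivity)
  have H := (H12.mul_of_nonneg H3 (fun n => by simp only [Pi.zero_apply]; positivity) hG).comp_injective gcdMap_inj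
  refine Summable.of_nonneg_of_le (fun q => ?_) (fun q => ?_) H
  · split_ifs <;> positivity
  split_ifs with hc
  swap
  · exact mul_nonneg (by positivity) (hG _)
  obtain ⟨x, y, z, w⟩ := q
  obtain ⟨g, m, n, g0, m0, n0, mn, e1, e2, e3, e4, e5⟩ := gcd_decomp x y
  obtain ⟨k, p, q, k0, p0, q0, pq, f1, f2, f3, f4, f5⟩ := gcd_decomp z w
  simp only [Function.comp, gcdMap, e1, e2, e3, f1, f2, f3]
  simp only [e4, e5, f4, f5, Nat.cast_mul] at hc ⊢
  have hmem : ((m, n), (p, q)) ∈ primS a b := by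
    refine ⟨m0, n0, p0, q0, mn, pq, ?_⟩
    simp only
    rw [Real.mul_rpow, Real.mul_rpow, Real.mul_rpow, Real.mul_rpow] at hc <;> try positivity
    have hgk : 0 < (g : ℝ) ^ a * (k : ℝ) ^ b := by positivity
    apply mul_left_cancel₀ hgk.ne'
    linear_combination hc
  rw [Set.indicator_of_mem hmem, primG, split_rpow, split_rpow] <;> try positivity
  apply le_of_eq
  ring
end

section
/- Let 1 ≤ a < b be fixed positive integers with gcd(a,b) = 1, and fix A > 0. Then for all T ≥ 10 and all real H, R with 2 ≤ H ≤ T^A and 2 ≤ R ≤ T^A, one has Σ₂(T; H, R, a, b) + Σ₂(T; H, R, b, a) ≪ T^{1/(a+b) − a/(b(a+b)(a+b−1))} (log T)⁴, where the implied constant depends only on a, b, A. -/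
open Real

/-- `η(h₁,r₁,h₂,r₂) = (h₁^a r₁^b)^{1/(a+b)} - (h₂^a r₂^b)^{1/(a+b)}`. -/
noncomputable def etaFn (a b : ℝ) (h₁ r₁ h₂ r₂ : ℕ+) : ℝ :=
  ((h₁ : ℝ) ^ a * (r₁ : ℝ) ^ b) ^ (1 / (a + b)) -
    ((h₂ : ℝ) ^ a * (r₂ : ℝ) ^ b) ^ (1 / (a + b))

open Classical in
/-- `Σ₂(T; H, R, a, b)`: the sum over quadruples `(h₁, h₂, r₁, r₂)` of positive integers
with `h₁, h₂ ≤ H`, `r₁, r₂ ≤ R` and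
`0 < |η(h₁,r₁,h₂,r₂)| < (1/10)(h₁^a r₁^b h₂^a r₂^b)^{1/(2(a+b))}` of the weights
`(h₁h₂)^{-(a+2b)/(2(a+b))} (r₁r₂)^{-(2a+b)/(2(a+b))} · min(T^{1/(a+b)}, 1/|η|)`. -/
noncomputable def Sigma2 (T H R a b : ℝ) : ℝ :=
  ∑' q : ℕ+ × ℕ+ × ℕ+ × ℕ+,
    if (q.1 : ℝ) ≤ H ∧ (q.2.1 : ℝ) ≤ H ∧ (q.2.2.1 : ℝ) ≤ R ∧ (q.2.2.2 : ℝ) ≤ R ∧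
        0 < |etaFn a b q.1 q.2.2.1 q.2.1 q.2.2.2| ∧
        |etaFn a b q.1 q.2.2.1 q.2.1 q.2.2.2| <
          (1 / 10) * ((q.1 : ℝ) ^ a * (q.2.2.1 : ℝ) ^ b *
            ((q.2.1 : ℝ) ^ a * (q.2.2.2 : ℝ) ^ b)) ^ (1 / (2 * (a + b))) then
      ((q.1 : ℝ) * (q.2.1 : ℝ)) ^ (-(a + 2 * b) / (2 * (a + b))) *
        ((q.2.2.1 : ℝ) * (q.2.2.2 : ℝ)) ^ (-(2 * a + b) / (2 * (a + b))) *
        min (T ^ (1 / (a + b))) (1 / |etaFn a b q.1 q.2.2.1 q.2.1 q.2.2.2|)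
    else 0

lemma aux_log_sep (m n : ℕ) (hm : 0 < m) (hn : 0 < n) (hne : m ≠ n) :
    1 / (2 * √((m : ℝ) * n)) ≤ |Real.log m - Real.log n| := by
  wlog h : n < m generalizing m n
  · have := this n m hn hm hne.symm (by omega)
    rwa [mul_comm (m : ℝ), abs_sub_comm]
  have hm' : (1 : ℝ) ≤ m := by exact_mod_cast hm
  have hn' : (1 : ℝ) ≤ n := by exact_mod_cast hn
  have h1 : (n : ℝ) + 1 ≤ m := by exact_mod_cast h
  have hlog : Real.log m - Real.log n = Real.log (m / n) := by
    rw [Real.log_div (by positivity) (by positivity)]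
  refine le_trans ?_ (le_abs_self _)
  rw [hlog]
  have hs1 : 1 ≤ √((m : ℝ) * n) := by
    rw [Real.one_le_sqrt]; nlinarith
  by_cases h2 : (2 : ℝ) * n ≤ m
  · have : Real.log 2 ≤ Real.log (m / n) := by
      apply Real.log_le_log (by norm_num)
      rw [le_div_iff₀ (by positivity)]; exact h2
    have h3 := Real.log_two_gt_d9
    have : 1 / (2 * √((m : ℝ) * n)) ≤ 1 / (2 * 1) := by gcongr
    linarith
  · push Not at h2
    have h3 := Real.one_sub_inv_le_log_of_pos (x := (m / n : ℝ)) (by positivity)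
    refine le_trans ?_ h3
    have h4 : (m : ℝ) / 2 ≤ √((m : ℝ) * n) := by
      apply Real.le_sqrt_of_sq_le; nlinarith
    calc 1 / (2 * √((m : ℝ) * n)) ≤ 1 / m := by
          apply one_div_le_one_div_of_le (by positivity); linarith
      _ ≤ _ := by
          rw [inv_div, one_sub_div (by positivity)]
          gcongr; linarith

lemma aux_sinh (y₁ y₂ : ℝ) (h1 : 0 < y₁) (h2 : 0 < y₂) :
    √(y₁ * y₂) * |Real.log y₁ - Real.log y₂| ≤ |y₁ - y₂| := by
  obtain ⟨x, rfl⟩ : ∃ x, y₁ = Real.exp x := ⟨_, (Real.exp_log h1).symm⟩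
  obtain ⟨y, rfl⟩ : ∃ x, y₂ = Real.exp x := ⟨_, (Real.exp_log h2).symm⟩
  have e1 : √(Real.exp x * Real.exp y) = Real.exp ((x + y) / 2) := by
    rw [← Real.exp_add, Real.exp_half]
  have e2 : Real.exp x - Real.exp y = Real.exp ((x + y) / 2) * (2 * Real.sinh ((x - y) / 2)) := by
    rw [Real.sinh_eq]
    have : Real.exp x = Real.exp ((x + y) / 2) * Real.exp ((x - y) / 2) := by
      rw [← Real.exp_add]; ring_nf
    rw [this]
    have : Real.exp y = Real.exp ((x + y) / 2) * Real.exp (-((x - y) / 2)) := by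
      rw [← Real.exp_add]; ring_nf
    rw [this]; ring
  rw [e1, e2, abs_mul, abs_of_pos (Real.exp_pos _), Real.log_exp, Real.log_exp]
  refine mul_le_mul_of_nonneg_left ?_ (Real.exp_pos _).le
  rw [abs_mul, Real.abs_sinh]
  have := Real.self_le_sinh_iff.2 (abs_nonneg ((x - y) / 2))
  have e3 : |(x - y) / 2| = |x - y| / 2 := by rw [abs_div, abs_two]
  rw [e3] at this ⊢
  rw [abs_two]
  linarith

/-- the bound with only real data -/
lemma aux_real (c T Y V L : ℝ) (n : ℤ) (hc : 3 ≤ c) (hT : 1 ≤ T) (hY : 0 < Y) (hV : Y ^ 2 ≤ V)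
    (E : ℝ) (hE : Y * (|L| / c) ≤ E) (hL : 1 / (2 * Y ^ c) ≤ |L|)
    (hn : (|(n : ℝ)| - 1) / (4 * V) ≤ |L|) :
    Y / V * min (T ^ (1 / c)) (1 / E) ≤
      12 * c * T ^ (1 / c - 1 / (c * (c - 1))) / (1 + |(n : ℝ)|) := by
  have hV0 : 0 < V := lt_of_lt_of_le (by positivity) hV
  have hL0 : 0 < |L| := lt_of_lt_of_le (by positivity) hL
  have hE0 : 0 < E := lt_of_lt_of_le (by positivity) hE
  have hth : 0 ≤ 1 / c - 1 / (c * (c - 1)) := by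
    rw [sub_nonneg]
    apply one_div_le_one_div_of_le (by positivity); nlinarith
  have hTt : 1 ≤ T ^ (1 / c - 1 / (c * (c - 1))) := Real.one_le_rpow hT hth
  have h1E : Y * (1 / E) ≤ c / |L| := by
    rw [mul_one_div, div_le_div_iff₀ hE0 hL0]
    have : Y * (|L| / c) * c = Y * |L| := by field_simp
    nlinarith
  rw [le_div_iff₀ (by positivity)]
  by_cases h2 : 2 ≤ |(n : ℝ)|
  · have h3 : Y / V * min (T ^ (1 / c)) (1 / E) ≤ c / |L| / V := by
      calc _ ≤ Y / V * (1 / E) := by gcongr; exact min_le_right _ _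
        _ = Y * (1 / E) / V := by ring
        _ ≤ _ := by gcongr
    have h4 : c / |L| / V * (1 + |(n : ℝ)|) ≤ 12 * c := by
      rw [div_div, div_mul_eq_mul_div, div_le_iff₀ (by positivity)]
      rw [div_le_iff₀ (by positivity)] at hn
      nlinarith
    calc _ ≤ c / |L| / V * (1 + |(n : ℝ)|) := by gcongr
      _ ≤ 12 * c := h4
      _ ≤ _ := by nlinarith
  · push Not at h2
    have key : Y / V * min (T ^ (1 / c)) (1 / E) ≤ 2 * c * T ^ (1 / c - 1 / (c * (c - 1))) := by
      have hVY : 1 / V ≤ 1 / Y ^ 2 := one_div_le_one_div_of_le (by positivity) hV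
      have hm0 : 0 ≤ min (T ^ (1 / c)) (1 / E) := by positivity
      have hb : Y / V * min (T ^ (1 / c)) (1 / E) ≤ Y * min (T ^ (1 / c)) (1 / E) / Y ^ 2 := by
        calc _ = Y * min (T ^ (1 / c)) (1 / E) * (1 / V) := by ring
          _ ≤ Y * min (T ^ (1 / c)) (1 / E) * (1 / Y ^ 2) := by gcongr
          _ = _ := by ring
      refine hb.trans ?_
      by_cases hYT : T ^ (1 / (c * (c - 1))) ≤ Y
      · calc _ ≤ Y * T ^ (1 / c) / Y ^ 2 := by gcongr; exact min_le_left _ _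
          _ = T ^ (1 / c) / Y := by field_simp
          _ ≤ T ^ (1 / c) / T ^ (1 / (c * (c - 1))) := by gcongr
          _ = T ^ (1 / c - 1 / (c * (c - 1))) := by rw [Real.rpow_sub (by positivity)]
          _ ≤ _ := by nlinarith
      · push Not at hYT
        calc _ ≤ Y * (1 / E) / Y ^ 2 := by gcongr; exact min_le_right _ _
          _ ≤ (c / |L|) / Y ^ 2 := by gcongr
          _ ≤ (c / (1 / (2 * Y ^ c))) / Y ^ 2 := by gcongr
          _ = 2 * c * (Y ^ c / Y ^ (2 : ℝ)) := by rw [Real.rpow_two]; field_simp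
          _ = 2 * c * Y ^ (c - 2) := by rw [Real.rpow_sub hY]
          _ ≤ 2 * c * (T ^ (1 / (c * (c - 1)))) ^ (c - 2) := by
              gcongr; linarith
          _ = _ := by
              rw [← Real.rpow_mul (by positivity)]
              congr 2
              have : c - 1 ≠ 0 := by linarith
              field_simp; ring
    have : 0 ≤ Y / V * min (T ^ (1 / c)) (1 / E) := by positivity
    nlinarith [abs_nonneg (n : ℝ)]

/-- the summand of `Sigma2` -/
noncomputable def auxTm (T a b h₁ h₂ r₁ r₂ : ℝ) : ℝ :=
  (h₁ * h₂) ^ (-(a + 2 * b) / (2 * (a + b))) * (r₁ * r₂) ^ (-(2 * a + b) / (2 * (a + b))) *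
    min (T ^ (1 / (a + b)))
      (1 / |(h₁ ^ a * r₁ ^ b) ^ (1 / (a + b)) - (h₂ ^ a * r₂ ^ b) ^ (1 / (a + b))|)

lemma aux_weight (a b d g u₁ u₂ v₁ v₂ : ℝ) (ha : 0 < a) (hb : 0 < b) (hd : 1 ≤ d) (hg : 1 ≤ g)
    (hu₁ : 0 < u₁) (hu₂ : 0 < u₂) (hv₁ : 0 < v₁) (hv₂ : 0 < v₂) :
    ((d * u₁) * (d * u₂)) ^ (-(a + 2 * b) / (2 * (a + b))) *
      ((g * v₁) * (g * v₂)) ^ (-(2 * a + b) / (2 * (a + b))) ≤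
    1 / (d * g * u₁ * u₂) *
      (√((u₁ ^ a * v₁ ^ b) ^ (1 / (a + b)) * (u₂ ^ a * v₂ ^ b) ^ (1 / (a + b))) / (v₁ * v₂)) := by
  have hd' := Real.log_nonneg hd
  have hg' := Real.log_nonneg hg
  have hd0 : 0 < d := by linarith
  have hg0 : 0 < g := by linarith
  rw [← Real.log_le_log_iff (by positivity) (by positivity)]
  rw [Real.log_mul (by positivity) (by positivity), Real.log_mul (by positivity) (by positivity),
    Real.log_rpow (by positivity), Real.log_rpow (by positivity),
    Real.log_div (by positivity) (by positivity), Real.log_div (by positivity) (by positivity),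
    Real.log_sqrt (by positivity), Real.log_one]
  rw [Real.log_mul (x := _ ^ _) (by positivity) (by positivity), Real.log_rpow (by positivity),
    Real.log_rpow (by positivity)]
  simp only [Real.log_mul, Real.log_rpow, hd0.ne', hg0.ne', hu₁.ne', hu₂.ne', hv₁.ne', hv₂.ne',
    ne_eq, not_false_eq_true, mul_eq_zero, or_self, hu₁, hu₂, hv₁, hv₂,
    (Real.rpow_pos_of_pos hu₁ a).ne', (Real.rpow_pos_of_pos hu₂ a).ne',
    (Real.rpow_pos_of_pos hv₁ b).ne', (Real.rpow_pos_of_pos hv₂ b).ne']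
  rw [← sub_nonneg]
  have : 0 ≤ (b * Real.log d + a * Real.log g) / (a + b) := by positivity
  convert this using 1
  field_simp
  ring

lemma aux_term (a b : ℕ) (ha : 1 ≤ a) (hb : 1 ≤ b) (hab : 3 ≤ a + b) (T : ℝ) (hT : 1 ≤ T)
    (d g u₁ u₂ v₁ v₂ : ℕ) (hd : 0 < d) (hg : 0 < g)
    (hu₁ : 0 < u₁) (hu₂ : 0 < u₂) (hv₁ : 0 < v₁) (hv₂ : 0 < v₂)
    (hne : u₁ ^ a * v₁ ^ b ≠ u₂ ^ a * v₂ ^ b) (hUV : u₁ * u₂ ≤ v₁ * v₂) (L : ℝ)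
    (hL : L = a * (Real.log u₁ - Real.log u₂) + b * (Real.log v₁ - Real.log v₂)) (n : ℤ)
    (hn : n = ⌊4 * 2 ^ (Nat.log 2 (v₁ * v₂)) * L⌋) :
    auxTm T a b (d * u₁) (d * u₂) (g * v₁) (g * v₂) ≤
      12 * (a + b) * T ^ (1 / ((a : ℝ) + b) - 1 / (((a : ℝ) + b) * ((a : ℝ) + b - 1))) *
        (1 / (d * g * u₁ * u₂) * (1 / (1 + |(n : ℝ)|))) := by
  have hd' : (1 : ℝ) ≤ d := by exact_mod_cast hd
  have hg' : (1 : ℝ) ≤ g := by exact_mod_cast hg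
  have hu₁' : (0 : ℝ) < u₁ := by exact_mod_cast hu₁
  have hu₂' : (0 : ℝ) < u₂ := by exact_mod_cast hu₂
  have hv₁' : (0 : ℝ) < v₁ := by exact_mod_cast hv₁
  have hv₂' : (0 : ℝ) < v₂ := by exact_mod_cast hv₂
  have ha' : (0 : ℝ) < a := by exact_mod_cast ha
  have hb' : (0 : ℝ) < b := by exact_mod_cast hb
  have hc : (3 : ℝ) ≤ (a : ℝ) + b := by exact_mod_cast hab
  have hw := aux_weight a b d g u₁ u₂ v₁ v₂ ha' hb' hd' hg' hu₁' hu₂' hv₁' hv₂'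
  set c : ℝ := (a : ℝ) + b with hcdef
  set y₁ : ℝ := ((u₁ : ℝ) ^ (a : ℝ) * (v₁ : ℝ) ^ (b : ℝ)) ^ (1 / c) with hy₁
  set y₂ : ℝ := ((u₂ : ℝ) ^ (a : ℝ) * (v₂ : ℝ) ^ (b : ℝ)) ^ (1 / c) with hy₂
  have hy₁0 : 0 < y₁ := by positivity
  have hy₂0 : 0 < y₂ := by positivity
  have hly₁ : Real.log y₁ = (a * Real.log u₁ + b * Real.log v₁) / c := by
    rw [hy₁, Real.log_rpow (by positivity), Real.log_mul (by positivity) (by positivity),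
      Real.log_rpow hu₁', Real.log_rpow hv₁']; ring
  have hly₂ : Real.log y₂ = (a * Real.log u₂ + b * Real.log v₂) / c := by
    rw [hy₂, Real.log_rpow (by positivity), Real.log_mul (by positivity) (by positivity),
      Real.log_rpow hu₂', Real.log_rpow hv₂']; ring
  have hLy : Real.log y₁ - Real.log y₂ = L / c := by rw [hly₁, hly₂, hL]; ring
  have hE := aux_sinh y₁ y₂ hy₁0 hy₂0
  rw [hLy, abs_div, abs_of_pos (show 0 < c by linarith)] at hE
  have hp1 : y₁ ^ c = (u₁ : ℝ) ^ a * (v₁ : ℝ) ^ b := by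
    rw [hy₁, ← Real.rpow_mul (by positivity), one_div_mul_cancel (by linarith), Real.rpow_one,
      Real.rpow_natCast, Real.rpow_natCast]
  have hp2 : y₂ ^ c = (u₂ : ℝ) ^ a * (v₂ : ℝ) ^ b := by
    rw [hy₂, ← Real.rpow_mul (by positivity), one_div_mul_cancel (by linarith), Real.rpow_one,
      Real.rpow_natCast, Real.rpow_natCast]
  have hYc : (√(y₁ * y₂)) ^ c = √((u₁ ^ a * v₁ ^ b : ℕ) * (u₂ ^ a * v₂ ^ b : ℕ)) := by
    push_cast
    rw [← hp1, ← hp2, ← Real.mul_rpow hy₁0.le hy₂0.le, Real.sqrt_eq_rpow, Real.sqrt_eq_rpow,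
      ← Real.rpow_mul (by positivity), ← Real.rpow_mul (by positivity), mul_comm (1 / 2 : ℝ)]
  have hsep := aux_log_sep _ _ (show 0 < u₁ ^ a * v₁ ^ b by positivity)
    (show 0 < u₂ ^ a * v₂ ^ b by positivity) hne
  rw [← hYc] at hsep
  have hLN : Real.log (u₁ ^ a * v₁ ^ b : ℕ) - Real.log (u₂ ^ a * v₂ ^ b : ℕ) = L := by
    push_cast
    rw [Real.log_mul (by positivity) (by positivity), Real.log_mul (by positivity) (by positivity),
      Real.log_pow, Real.log_pow, Real.log_pow, Real.log_pow, hL]; ring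
  rw [hLN] at hsep
  have hUV' : (u₁ : ℝ) * u₂ ≤ v₁ * v₂ := by exact_mod_cast hUV
  have hYV : (√(y₁ * y₂)) ^ 2 ≤ (v₁ : ℝ) * v₂ := by
    rw [Real.sq_sqrt (by positivity), ← Real.rpow_le_rpow_iff (z := c) (by positivity)
      (by positivity) (by linarith), Real.mul_rpow hy₁0.le hy₂0.le, hp1, hp2]
    calc (u₁ : ℝ) ^ a * (v₁ : ℝ) ^ b * ((u₂ : ℝ) ^ a * (v₂ : ℝ) ^ b)
        = ((u₁ : ℝ) * u₂) ^ a * ((v₁ : ℝ) * v₂) ^ b := by rw [mul_pow, mul_pow]; ring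
      _ ≤ ((v₁ : ℝ) * v₂) ^ a * ((v₁ : ℝ) * v₂) ^ b := by gcongr
      _ = _ := by rw [hcdef, Real.rpow_add (by positivity), Real.rpow_natCast, Real.rpow_natCast]
  have hV2 : (2 : ℝ) ^ (Nat.log 2 (v₁ * v₂)) ≤ (v₁ : ℝ) * v₂ := by
    exact_mod_cast Nat.pow_log_le_self 2 (show v₁ * v₂ ≠ 0 by positivity)
  have hnL : (|(n : ℝ)| - 1) / (4 * ((v₁ : ℝ) * v₂)) ≤ |L| := by
    rw [div_le_iff₀ (by positivity)]
    have f1 : (n : ℝ) ≤ 4 * 2 ^ (Nat.log 2 (v₁ * v₂)) * L := by rw [hn]; exact Int.floor_le _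
    have f2 : 4 * 2 ^ (Nat.log 2 (v₁ * v₂)) * L < (n : ℝ) + 1 := by
      rw [hn]; exact Int.lt_floor_add_one _
    have f3 : |(n : ℝ)| - 1 ≤ |4 * 2 ^ (Nat.log 2 (v₁ * v₂)) * L| := by
      rcases abs_cases (n : ℝ) with ⟨h, _⟩ | ⟨h, _⟩ <;> rw [h]
      · refine le_trans ?_ (le_abs_self _); linarith
      · refine le_trans ?_ (neg_le_abs _); linarith
    refine f3.trans ?_
    rw [abs_mul, abs_of_pos (by positivity), mul_comm]
    gcongr
  have hmain := aux_real c T (√(y₁ * y₂)) (v₁ * v₂) L n hc hT (by positivity) hYV _ hE hsep hnL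
  -- eta
  have hη : |((d * u₁ : ℝ) ^ (a : ℝ) * (g * v₁ : ℝ) ^ (b : ℝ)) ^ (1 / c) -
      ((d * u₂ : ℝ) ^ (a : ℝ) * (g * v₂ : ℝ) ^ (b : ℝ)) ^ (1 / c)| ≥ |y₁ - y₂| := by
    have hD : 1 ≤ ((d : ℝ) ^ (a : ℝ) * (g : ℝ) ^ (b : ℝ)) ^ (1 / c) := by
      apply Real.one_le_rpow
      · exact one_le_mul_of_one_le_of_one_le (Real.one_le_rpow hd' ha'.le)
          (Real.one_le_rpow hg' hb'.le)
      · positivity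
    have e : ∀ u v : ℝ, 0 < u → 0 < v → ((d * u : ℝ) ^ (a : ℝ) * (g * v : ℝ) ^ (b : ℝ)) ^ (1 / c) =
        ((d : ℝ) ^ (a : ℝ) * (g : ℝ) ^ (b : ℝ)) ^ (1 / c) *
          (u ^ (a : ℝ) * v ^ (b : ℝ)) ^ (1 / c) := by
      intro u v hu hv
      rw [← Real.mul_rpow (by positivity) (by positivity), Real.mul_rpow (by positivity) hu.le,
        Real.mul_rpow (by positivity) hv.le]
      congr 1; ring
    rw [e _ _ hu₁' hv₁', e _ _ hu₂' hv₂', ← mul_sub, abs_mul, abs_of_pos (by positivity)]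
    exact le_mul_of_one_le_left (abs_nonneg _) hD
  have hEpos : 0 < |y₁ - y₂| := by
    refine lt_of_lt_of_le ?_ hE
    have : 0 < |L| := lt_of_lt_of_le (by positivity) hsep
    positivity
  unfold auxTm
  calc _ ≤ 1 / (d * g * u₁ * u₂) * (√(y₁ * y₂) / (v₁ * v₂)) *
        min (T ^ (1 / c)) (1 / |y₁ - y₂|) := by
        apply mul_le_mul hw _ (by positivity) (by positivity)
        exact min_le_min_left _ (one_div_le_one_div_of_le hEpos hη)
    _ = 1 / (d * g * u₁ * u₂) * (√(y₁ * y₂) / (v₁ * v₂) *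
        min (T ^ (1 / c)) (1 / |y₁ - y₂|)) := by ring
    _ ≤ 1 / (d * g * u₁ * u₂) * (12 * c * T ^ (1 / c - 1 / (c * (c - 1))) / (1 + |(n : ℝ)|)) := by
        gcongr
    _ = _ := by ring

lemma aux_coprime (v₁ v₂ w₁ w₂ : ℕ) (hv : Nat.Coprime v₁ v₂) (hw : Nat.Coprime w₁ w₂)
    (hv₁ : 0 < v₁) (h : v₁ * w₂ = v₂ * w₁) : v₁ = w₁ ∧ v₂ = w₂ := by
  have h1 : v₁ ∣ w₁ := hv.dvd_of_dvd_mul_left (Dvd.intro _ h)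
  have h2 : w₁ ∣ v₁ := hw.dvd_of_dvd_mul_right (Dvd.intro_left _ h.symm)
  have h3 := Nat.dvd_antisymm h1 h2
  subst h3
  refine ⟨rfl, ?_⟩
  rw [mul_comm v₂] at h
  exact (Nat.eq_of_mul_eq_mul_left hv₁ h).symm

lemma aux_inj (b : ℕ) (hb : 1 ≤ b) (α : ℝ) (v₁ v₂ w₁ w₂ : ℕ) (hv : Nat.Coprime v₁ v₂)
    (hw : Nat.Coprime w₁ w₂) (hv₁ : 0 < v₁) (hv₂ : 0 < v₂) (hw₁ : 0 < w₁) (hw₂ : 0 < w₂)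
    (hj : Nat.log 2 (v₁ * v₂) = Nat.log 2 (w₁ * w₂))
    (hn : ⌊4 * 2 ^ (Nat.log 2 (v₁ * v₂)) * (α + b * (Real.log v₁ - Real.log v₂))⌋ =
      ⌊4 * 2 ^ (Nat.log 2 (w₁ * w₂)) * (α + b * (Real.log w₁ - Real.log w₂))⌋) :
    v₁ = w₁ ∧ v₂ = w₂ := by
  apply aux_coprime v₁ v₂ w₁ w₂ hv hw hv₁
  by_contra hne
  have hv₁' : (0 : ℝ) < v₁ := by exact_mod_cast hv₁
  have hv₂' : (0 : ℝ) < v₂ := by exact_mod_cast hv₂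
  have hw₁' : (0 : ℝ) < w₁ := by exact_mod_cast hw₁
  have hw₂' : (0 : ℝ) < w₂ := by exact_mod_cast hw₂
  have hsep := aux_log_sep _ _ (show 0 < v₁ * w₂ by positivity) (show 0 < v₂ * w₁ by positivity) hne
  push_cast at hsep
  rw [Real.log_mul hv₁'.ne' hw₂'.ne', Real.log_mul hv₂'.ne' hw₁'.ne'] at hsep
  have hlt := Int.abs_sub_lt_one_of_floor_eq_floor hn
  rw [← hj] at hlt
  have hVlt : (v₁ : ℝ) * v₂ < 2 * 2 ^ (Nat.log 2 (v₁ * v₂)) := by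
    have := Nat.lt_pow_succ_log_self (b := 2) (by norm_num) (v₁ * v₂)
    rw [pow_succ, mul_comm _ 2] at this
    exact_mod_cast this
  have hWlt : (w₁ : ℝ) * w₂ < 2 * 2 ^ (Nat.log 2 (v₁ * v₂)) := by
    have := Nat.lt_pow_succ_log_self (b := 2) (by norm_num) (w₁ * w₂)
    rw [← hj, pow_succ, mul_comm _ 2] at this
    exact_mod_cast this
  set P : ℝ := 2 ^ (Nat.log 2 (v₁ * v₂)) with hP
  have hP0 : 0 < P := by positivity
  have hb' : (1 : ℝ) ≤ b := by exact_mod_cast hb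
  have hs : √((v₁ : ℝ) * w₂ * (v₂ * w₁)) ≤ 2 * P := by
    apply Real.sqrt_le_iff.2 ⟨by positivity, ?_⟩
    calc (v₁ : ℝ) * w₂ * (v₂ * w₁) = (v₁ * v₂) * (w₁ * w₂) := by ring
      _ ≤ (2 * P) * (2 * P) := by gcongr
      _ = _ := by ring
  have h1 : 1 / (2 * (2 * P)) ≤ 1 / (2 * √((v₁ : ℝ) * w₂ * (v₂ * w₁))) := by gcongr
  have h2 := h1.trans hsep
  have e : 4 * P * (α + b * (Real.log v₁ - Real.log v₂)) -
      4 * P * (α + b * (Real.log w₁ - Real.log w₂)) =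
      (4 * P) * (b * (Real.log v₁ + Real.log w₂ - (Real.log v₂ + Real.log w₁))) := by ring
  rw [e, abs_mul, abs_of_pos (show 0 < 4 * P by positivity), abs_mul,
    abs_of_pos (show (0 : ℝ) < b by linarith)] at hlt
  rw [div_le_iff₀ (by positivity)] at h2
  have h3 : 0 ≤ |Real.log v₁ + Real.log w₂ - (Real.log v₂ + Real.log w₁)| * (4 * P) := by positivity
  nlinarith

/-- the level -/
noncomputable def auxN (a b : ℕ) (u₁ u₂ v₁ v₂ : ℕ) : ℤ :=
  ⌊4 * 2 ^ (Nat.log 2 (v₁ * v₂)) *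
    ((a : ℝ) * (Real.log u₁ - Real.log u₂) + b * (Real.log v₁ - Real.log v₂))⌋

/-- the encoding of the quadruples -/
noncomputable def auxPhi (a b : ℕ) (q : ℕ × ℕ × ℕ × ℕ) : Fin 7 → ℕ :=
  let d := Nat.gcd q.1 q.2.1
  let g := Nat.gcd q.2.2.1 q.2.2.2
  let n := auxN a b (q.1 / d) (q.2.1 / d) (q.2.2.1 / g) (q.2.2.2 / g)
  ![d, g, q.1 / d, q.2.1 / d, Nat.log 2 ((q.2.2.1 / g) * (q.2.2.2 / g)), n.toNat, (-n).toNat]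

lemma aux_phi_inj (a b : ℕ) (hb : 1 ≤ b) :
    Set.InjOn (auxPhi a b) {q | 0 < q.1 ∧ 0 < q.2.1 ∧ 0 < q.2.2.1 ∧ 0 < q.2.2.2} := by
  rintro ⟨h₁, h₂, r₁, r₂⟩ ⟨p1, p2, p3, p4⟩ ⟨k₁, k₂, s₁, s₂⟩ ⟨p5, p6, p7, p8⟩ h
  simp only at p1 p2 p3 p4 p5 p6 p7 p8
  have e0 := congrFun h 0
  have e1 := congrFun h 1
  have e2 := congrFun h 2
  have e3 := congrFun h 3
  have e4 := congrFun h 4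
  have e5 := congrFun h 5
  have e6 := congrFun h 6
  simp only [auxPhi] at e0 e1 e2 e3 e4 e5 e6
  simp at e0 e1 e2 e3 e4 e5 e6
  have hn : auxN a b (h₁ / Nat.gcd h₁ h₂) (h₂ / Nat.gcd h₁ h₂) (r₁ / Nat.gcd r₁ r₂)
      (r₂ / Nat.gcd r₁ r₂) = auxN a b (k₁ / Nat.gcd k₁ k₂) (k₂ / Nat.gcd k₁ k₂)
      (s₁ / Nat.gcd s₁ s₂) (s₂ / Nat.gcd s₁ s₂) := by omega
  unfold auxN at hn
  rw [e2, e3] at hn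
  have hg1 := Nat.gcd_pos_of_pos_left r₂ p3
  have hg2 := Nat.gcd_pos_of_pos_left s₂ p7
  obtain ⟨f1, f2⟩ := aux_inj b hb _ _ _ _ _ (Nat.coprime_div_gcd_div_gcd hg1)
    (Nat.coprime_div_gcd_div_gcd hg2)
    (Nat.div_pos (Nat.gcd_le_left _ p3) hg1) (Nat.div_pos (Nat.gcd_le_right _ p4) hg1)
    (Nat.div_pos (Nat.gcd_le_left _ p7) hg2) (Nat.div_pos (Nat.gcd_le_right _ p8) hg2) e4 hn
  have d1 := Nat.div_mul_cancel (Nat.gcd_dvd_left h₁ h₂)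
  have d2 := Nat.div_mul_cancel (Nat.gcd_dvd_right h₁ h₂)
  have d3 := Nat.div_mul_cancel (Nat.gcd_dvd_left r₁ r₂)
  have d4 := Nat.div_mul_cancel (Nat.gcd_dvd_right r₁ r₂)
  rw [e2, e0, Nat.div_mul_cancel (Nat.gcd_dvd_left _ _)] at d1
  rw [e3, e0, Nat.div_mul_cancel (Nat.gcd_dvd_right _ _)] at d2
  rw [f1, e1, Nat.div_mul_cancel (Nat.gcd_dvd_left _ _)] at d3
  rw [f2, e1, Nat.div_mul_cancel (Nat.gcd_dvd_right _ _)] at d4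
  rw [d1, d2, d3, d4]

/-- sum over the box -/
lemma aux_box {ι : Type*} (s : Finset ι) (φ : ι → Fin 7 → ℕ) (hφ : Set.InjOn φ s) (X : ℕ)
    (hX : ∀ q ∈ s, ∀ i, φ q i < X) :
    ∑ q ∈ s, ∏ i, (1 / ((φ q i : ℝ) + 1)) ≤ (1 + Real.log X) ^ 7 := by
  classical
  have h1 : ∑ q ∈ s, ∏ i, (1 / ((φ q i : ℝ) + 1)) =
      ∑ p ∈ s.image φ, ∏ i, (1 / ((p i : ℝ) + 1)) := by
    rw [Finset.sum_image hφ]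
  have h2 : s.image φ ⊆ Fintype.piFinset (fun _ : Fin 7 => Finset.range X) := by
    intro p hp
    obtain ⟨q, hq, rfl⟩ := Finset.mem_image.1 hp
    simp only [Fintype.mem_piFinset, Finset.mem_range]
    exact hX q hq
  rw [h1]
  refine (Finset.sum_le_sum_of_subset_of_nonneg h2 (fun _ _ _ => by positivity)).trans ?_
  rw [← Finset.prod_univ_sum (fun _ : Fin 7 => Finset.range X) (fun _ m => 1 / ((m : ℝ) + 1))]
  simp only [Finset.prod_const, Finset.card_univ, Fintype.card_fin]
  have h3 := harmonic_le_one_add_log X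
  have h4 : ((harmonic X : ℚ) : ℝ) = ∑ m ∈ Finset.range X, (1 / ((m : ℝ) + 1)) := by
    unfold harmonic
    push_cast
    simp
  rw [h4] at h3
  apply pow_le_pow_left₀ (Finset.sum_nonneg fun _ _ => by positivity) h3

/-- condition on the quadruples -/
def auxP (q : ℕ × ℕ × ℕ × ℕ) : Prop :=
  (q.1 / Nat.gcd q.1 q.2.1) * (q.2.1 / Nat.gcd q.1 q.2.1) ≤
    (q.2.2.1 / Nat.gcd q.2.2.1 q.2.2.2) * (q.2.2.2 / Nat.gcd q.2.2.1 q.2.2.2)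

/-- admissible quadruples -/
def auxAdm (a b : ℕ) (X Y : ℝ) (q : ℕ × ℕ × ℕ × ℕ) : Prop :=
  0 < q.1 ∧ 0 < q.2.1 ∧ 0 < q.2.2.1 ∧ 0 < q.2.2.2 ∧
  (q.1 : ℝ) ≤ X ∧ (q.2.1 : ℝ) ≤ X ∧ (q.2.2.1 : ℝ) ≤ Y ∧ (q.2.2.2 : ℝ) ≤ Y ∧
  q.1 ^ a * q.2.2.1 ^ b ≠ q.2.1 ^ a * q.2.2.2 ^ b

lemma aux_logdiff (x y B : ℝ) (hx : 1 ≤ x) (hy : 1 ≤ y) (hx' : x ≤ B) (hy' : y ≤ B) :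
    |Real.log x - Real.log y| ≤ Real.log B := by
  have h1 := Real.log_nonneg hx
  have h2 := Real.log_nonneg hy
  have h3 := Real.log_le_log (by linarith) hx'
  have h4 := Real.log_le_log (by linarith) hy'
  rw [abs_le]; constructor <;> linarith

lemma aux_pt (a b : ℕ) (ha : 1 ≤ a) (hb : 1 ≤ b) (hab : 3 ≤ a + b) (A : ℝ) (hA : 0 < A)
    (T : ℝ) (hT : 10 ≤ T) (q : ℕ × ℕ × ℕ × ℕ) (hq : auxAdm a b (T ^ A) (T ^ A) q) (hP : auxP q) :
    auxTm T a b q.1 q.2.1 q.2.2.1 q.2.2.2 ≤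
      (192 * (a + b) * T ^ (1 / ((a : ℝ) + b) - 1 / (((a : ℝ) + b) * ((a : ℝ) + b - 1))) *
        ((4 * A + 1) * Real.log T)) * ∏ i, (1 / ((auxPhi a b q i : ℝ) + 1)) ∧
    ∀ i, (auxPhi a b q i : ℝ) ≤ (4 * (a + b) * A + 2) * T ^ (2 * A + 1) := by
  obtain ⟨h₁, h₂, r₁, r₂⟩ := q
  obtain ⟨p1, p2, p3, p4, b1, b2, b3, b4, hne⟩ := hq
  simp only [auxP] at p1 p2 p3 p4 b1 b2 b3 b4 hne hP ⊢
  have hd := Nat.gcd_pos_of_pos_left h₂ p1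
  have hg := Nat.gcd_pos_of_pos_left r₂ p3
  have hu₁ := Nat.div_pos (Nat.gcd_le_left h₂ p1) hd
  have hu₂ := Nat.div_pos (Nat.gcd_le_right h₁ p2) hd
  have hv₁ := Nat.div_pos (Nat.gcd_le_left r₂ p3) hg
  have hv₂ := Nat.div_pos (Nat.gcd_le_right r₁ p4) hg
  have d1 := Nat.mul_div_cancel' (Nat.gcd_dvd_left h₁ h₂)
  have d2 := Nat.mul_div_cancel' (Nat.gcd_dvd_right h₁ h₂)
  have d3 := Nat.mul_div_cancel' (Nat.gcd_dvd_left r₁ r₂)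
  have d4 := Nat.mul_div_cancel' (Nat.gcd_dvd_right r₁ r₂)
  have hφ : auxPhi a b (h₁, h₂, r₁, r₂) = ![Nat.gcd h₁ h₂, Nat.gcd r₁ r₂, h₁ / Nat.gcd h₁ h₂,
    h₂ / Nat.gcd h₁ h₂, Nat.log 2 ((r₁ / Nat.gcd r₁ r₂) * (r₂ / Nat.gcd r₁ r₂)),
    (auxN a b (h₁ / Nat.gcd h₁ h₂) (h₂ / Nat.gcd h₁ h₂) (r₁ / Nat.gcd r₁ r₂)
      (r₂ / Nat.gcd r₁ r₂)).toNat, (-(auxN a b (h₁ / Nat.gcd h₁ h₂) (h₂ / Nat.gcd h₁ h₂)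
      (r₁ / Nat.gcd r₁ r₂) (r₂ / Nat.gcd r₁ r₂))).toNat] := rfl
  rw [hφ]
  clear hφ
  generalize Nat.gcd h₁ h₂ = d at *
  generalize Nat.gcd r₁ r₂ = g at *
  generalize h₁ / d = u₁ at *
  generalize h₂ / d = u₂ at *
  generalize r₁ / g = v₁ at *
  generalize r₂ / g = v₂ at *
  subst d1 d2 d3 d4
  have hne' : u₁ ^ a * v₁ ^ b ≠ u₂ ^ a * v₂ ^ b := by
    intro h
    apply hne
    calc (d * u₁) ^ a * (g * v₁) ^ b = d ^ a * g ^ b * (u₁ ^ a * v₁ ^ b) := by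
          rw [mul_pow, mul_pow]; ring
      _ = d ^ a * g ^ b * (u₂ ^ a * v₂ ^ b) := by rw [h]
      _ = _ := by rw [mul_pow, mul_pow]; ring
  have hterm := aux_term a b ha hb hab T (by linarith) d g u₁ u₂ v₁ v₂ hd hg hu₁ hu₂ hv₁ hv₂ hne'
    hP _ rfl (auxN a b u₁ u₂ v₁ v₂) rfl
  have hn1 : ((auxN a b u₁ u₂ v₁ v₂ : ℤ) : ℝ) ≤ 4 * 2 ^ (Nat.log 2 (v₁ * v₂)) *
    ((a : ℝ) * (Real.log u₁ - Real.log u₂) + b * (Real.log v₁ - Real.log v₂)) := Int.floor_le _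
  have hn2 : 4 * 2 ^ (Nat.log 2 (v₁ * v₂)) *
    ((a : ℝ) * (Real.log u₁ - Real.log u₂) + b * (Real.log v₁ - Real.log v₂)) <
      ((auxN a b u₁ u₂ v₁ v₂ : ℤ) : ℝ) + 1 := Int.lt_floor_add_one _
  generalize auxN a b u₁ u₂ v₁ v₂ = n at *
  have hd' : (1 : ℝ) ≤ d := by exact_mod_cast hd
  have hg' : (1 : ℝ) ≤ g := by exact_mod_cast hg
  have hu₁' : (1 : ℝ) ≤ u₁ := by exact_mod_cast hu₁
  have hu₂' : (1 : ℝ) ≤ u₂ := by exact_mod_cast hu₂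
  have hv₁' : (1 : ℝ) ≤ v₁ := by exact_mod_cast hv₁
  have hv₂' : (1 : ℝ) ≤ v₂ := by exact_mod_cast hv₂
  push_cast at b1 b2 b3 b4 ⊢
  have hT0 : 0 < T := by linarith
  have bu₁ : (u₁ : ℝ) ≤ T ^ A := (le_mul_of_one_le_left (by linarith) hd').trans b1
  have bu₂ : (u₂ : ℝ) ≤ T ^ A := (le_mul_of_one_le_left (by linarith) hd').trans b2
  have bv₁ : (v₁ : ℝ) ≤ T ^ A := (le_mul_of_one_le_left (by linarith) hg').trans b3
  have bv₂ : (v₂ : ℝ) ≤ T ^ A := (le_mul_of_one_le_left (by linarith) hg').trans b4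
  have bd : (d : ℝ) ≤ T ^ A := (le_mul_of_one_le_right (by linarith) hu₁').trans b1
  have bg : (g : ℝ) ≤ T ^ A := (le_mul_of_one_le_right (by linarith) hv₁').trans b3
  have hV2 : (2 : ℝ) ^ (Nat.log 2 (v₁ * v₂)) ≤ (v₁ : ℝ) * v₂ := by
    exact_mod_cast Nat.pow_log_le_self 2 (show v₁ * v₂ ≠ 0 by positivity)
  have hVT : (v₁ : ℝ) * v₂ ≤ T ^ (2 * A) := by
    rw [two_mul, Real.rpow_add hT0]; gcongr
  have hlogT : 1 ≤ Real.log T := by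
    rw [Real.le_log_iff_exp_le hT0]
    have := Real.exp_one_lt_d9; linarith
  have hlogTT : Real.log T ≤ T := Real.log_le_self hT0.le
  have hlogA : Real.log (T ^ A) = A * Real.log T := Real.log_rpow hT0 A
  have hTA1 : T ^ A ≤ T ^ (2 * A + 1) := Real.rpow_le_rpow_of_exponent_le (by linarith) (by linarith)
  have hTA2 : T ^ (2 * A) ≤ T ^ (2 * A + 1) :=
    Real.rpow_le_rpow_of_exponent_le (by linarith) (by linarith)
  have hTA0 : 1 ≤ T ^ (2 * A + 1) := Real.one_le_rpow (by linarith) (by linarith)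
  have hTA3 : T ^ (2 * A + 1) = T ^ (2 * A) * T := by rw [Real.rpow_add hT0, Real.rpow_one]
  have hK : T ^ (2 * A + 1) ≤ (4 * (a + b) * A + 2) * T ^ (2 * A + 1) := by
    apply le_mul_of_one_le_left (by linarith)
    have : 0 ≤ 4 * ((a : ℝ) + b) * A := by positivity
    linarith
  have hnabs : |(n : ℝ)| ≤ (4 * (a + b) * A + 2) * T ^ (2 * A + 1) := by
    have hLb : |(a : ℝ) * (Real.log u₁ - Real.log u₂) + b * (Real.log v₁ - Real.log v₂)| ≤
        ((a : ℝ) + b) * (A * T) := by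
      have l1 := aux_logdiff _ _ _ hu₁' hu₂' bu₁ bu₂
      have l2 := aux_logdiff _ _ _ hv₁' hv₂' bv₁ bv₂
      rw [hlogA] at l1 l2
      have l3 : A * Real.log T ≤ A * T := by gcongr
      refine (abs_add_le _ _).trans ?_
      rw [abs_mul, abs_mul, Nat.abs_cast, Nat.abs_cast, add_mul]
      gcongr <;> linarith
    set L := (a : ℝ) * (Real.log u₁ - Real.log u₂) + b * (Real.log v₁ - Real.log v₂)
    have f3 : |(n : ℝ)| ≤ |4 * 2 ^ (Nat.log 2 (v₁ * v₂)) * L| + 1 := by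
      have g1 := le_abs_self (4 * 2 ^ (Nat.log 2 (v₁ * v₂)) * L)
      have g2 := neg_le_abs (4 * 2 ^ (Nat.log 2 (v₁ * v₂)) * L)
      rw [abs_le]; constructor <;> linarith
    rw [abs_mul, abs_of_pos (show (0 : ℝ) < 4 * 2 ^ (Nat.log 2 (v₁ * v₂)) by positivity)] at f3
    calc _ ≤ _ := f3
      _ ≤ 4 * T ^ (2 * A) * (((a : ℝ) + b) * (A * T)) + T ^ (2 * A + 1) := by
          have := hV2.trans hVT
          gcongr
      _ = (4 * (a + b) * A + 1) * T ^ (2 * A + 1) := by rw [hTA3]; ring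
      _ ≤ _ := by gcongr; norm_num
  have hj1 : ((Nat.log 2 (v₁ * v₂) : ℕ) : ℝ) ≤ T ^ (2 * A) := by
    refine le_trans ?_ (hV2.trans hVT)
    exact_mod_cast (Nat.lt_two_pow_self).le
  have hj2 : ((Nat.log 2 (v₁ * v₂) : ℕ) : ℝ) + 1 ≤ (4 * A + 1) * Real.log T := by
    have := Real.log_le_log (by positivity) (hV2.trans hVT)
    rw [Real.log_pow, Real.log_rpow hT0] at this
    have l2 := Real.log_two_gt_d9
    have : ((Nat.log 2 (v₁ * v₂) : ℕ) : ℝ) * (1 / 2) ≤ ((Nat.log 2 (v₁ * v₂) : ℕ) : ℝ) * Real.log 2 := by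
      gcongr; linarith
    linarith
  generalize Nat.log 2 (v₁ * v₂) = j at *
  have hnp : ((n.toNat : ℕ) : ℝ) ≤ |(n : ℝ)| := by
    have : (n.toNat : ℤ) ≤ |n| := by rcases abs_cases n with h | h <;> omega
    exact_mod_cast this
  have hnm : (((-n).toNat : ℕ) : ℝ) ≤ |(n : ℝ)| := by
    have : ((-n).toNat : ℤ) ≤ |n| := by rcases abs_cases n with h | h <;> omega
    exact_mod_cast this
  constructor
  · refine hterm.trans ?_
    have hn3 : (1 : ℝ) / (1 + |(n : ℝ)|) =
        1 / ((n.toNat : ℝ) + 1) * (1 / (((-n).toNat : ℝ) + 1)) := by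
      rcases le_total 0 n with h | h
      · have e1 : (-n).toNat = 0 := by omega
        have e2 : ((n.toNat : ℕ) : ℝ) = |(n : ℝ)| := by
          have : (n.toNat : ℤ) = |n| := by rw [abs_of_nonneg h]; omega
          exact_mod_cast this
        rw [e1, e2, add_comm]; simp
      · have e1 : n.toNat = 0 := by omega
        have e2 : (((-n).toNat : ℕ) : ℝ) = |(n : ℝ)| := by
          have : ((-n).toNat : ℤ) = |n| := by rw [abs_of_nonpos h]; omega
          exact_mod_cast this
        rw [e1, e2, add_comm]; simp
    have hone : ∀ x : ℝ, 1 ≤ x → 1 / x ≤ 2 * (1 / (x + 1)) := by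
      intro x hx
      rw [mul_one_div, div_le_div_iff₀ (by linarith) (by linarith)]; linarith
    have hprod : (1 : ℝ) / (d * g * u₁ * u₂) ≤ 16 * ((1 / ((d : ℝ) + 1)) * (1 / ((g : ℝ) + 1)) *
        (1 / ((u₁ : ℝ) + 1)) * (1 / ((u₂ : ℝ) + 1))) := by
      calc (1 : ℝ) / (d * g * u₁ * u₂) = (1 / d) * (1 / g) * (1 / u₁) * (1 / u₂) := by
            field_simp
        _ ≤ (2 * (1 / ((d : ℝ) + 1))) * (2 * (1 / ((g : ℝ) + 1))) *
        (2 * (1 / ((u₁ : ℝ) + 1))) * (2 * (1 / ((u₂ : ℝ) + 1))) := by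
            gcongr <;> apply hone <;> assumption
        _ = _ := by ring
    have hjj : (1 : ℝ) ≤ ((4 * A + 1) * Real.log T) * (1 / ((j : ℝ) + 1)) := by
      rw [mul_one_div, le_div_iff₀ (by positivity), one_mul]; exact hj2
    rw [hn3]
    simp only [Fin.prod_univ_succ, Fin.prod_univ_zero]
    simp only [Matrix.cons_val_zero, Matrix.cons_val_succ]
    set Θ := T ^ (1 / ((a : ℝ) + b) - 1 / (((a : ℝ) + b) * ((a : ℝ) + b - 1)))
    have hΘ : 0 < Θ := by positivity
    set N := 1 / ((n.toNat : ℝ) + 1) * (1 / (((-n).toNat : ℝ) + 1)) with hN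
    have hN0 : 0 < N := by positivity
    calc 12 * ((a : ℝ) + b) * Θ * (1 / (d * g * u₁ * u₂) * N)
        = 12 * ((a : ℝ) + b) * Θ * (1 / (d * g * u₁ * u₂) * 1 * N) := by ring
      _ ≤ 12 * ((a : ℝ) + b) * Θ * (16 * ((1 / ((d : ℝ) + 1)) * (1 / ((g : ℝ) + 1)) *
        (1 / ((u₁ : ℝ) + 1)) * (1 / ((u₂ : ℝ) + 1))) *
          (((4 * A + 1) * Real.log T) * (1 / ((j : ℝ) + 1))) * N) := by gcongr
      _ = _ := by rw [hN]; ring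
  · intro i
    fin_cases i
    · show (d : ℝ) ≤ _
      linarith
    · show (g : ℝ) ≤ _
      linarith
    · show (u₁ : ℝ) ≤ _
      linarith
    · show (u₂ : ℝ) ≤ _
      linarith
    · show (j : ℝ) ≤ _
      linarith
    · show ((n.toNat : ℕ) : ℝ) ≤ _
      linarith
    · show (((-n).toNat : ℕ) : ℝ) ≤ _
      linarith

lemma aux_core (a b : ℕ) (ha : 1 ≤ a) (hb : 1 ≤ b) (hab : 3 ≤ a + b) (A : ℝ) (hA : 0 < A) :
    ∃ C > (0 : ℝ), ∀ T : ℝ, 10 ≤ T → ∀ s : Finset (ℕ × ℕ × ℕ × ℕ),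
      (∀ q ∈ s, auxAdm a b (T ^ A) (T ^ A) q ∧ auxP q) →
      ∑ q ∈ s, auxTm T a b q.1 q.2.1 q.2.2.1 q.2.2.2 ≤
        C * T ^ (1 / ((a : ℝ) + b) - 1 / (((a : ℝ) + b) * ((a : ℝ) + b - 1))) *
          (Real.log T) ^ 8 := by
  set K : ℝ := 4 * (a + b) * A + 2 with hK
  have hK1 : 2 ≤ K := by
    have : 0 ≤ 4 * ((a : ℝ) + b) * A := by positivity
    linarith
  set C1 : ℝ := 1 + Real.log (2 * K) + (2 * A + 1) with hC1
  have hlK : 0 ≤ Real.log (2 * K) := Real.log_nonneg (by linarith)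
  have hC1p : 0 < C1 := by positivity
  have ha' : (0 : ℝ) < a := by exact_mod_cast ha
  refine ⟨192 * (a + b) * (4 * A + 1) * C1 ^ 7, by positivity, ?_⟩
  intro T hT s hs
  have hT0 : 0 < T := by linarith
  have hlogT : 1 ≤ Real.log T := by
    rw [Real.le_log_iff_exp_le hT0]
    have := Real.exp_one_lt_d9; linarith
  have hTA0 : 1 ≤ T ^ (2 * A + 1) := Real.one_le_rpow (by linarith) (by linarith)
  set X : ℕ := ⌊K * T ^ (2 * A + 1)⌋₊ + 1 with hX
  have hbox := aux_box s (auxPhi a b) (fun q hq q' hq' h => aux_phi_inj a b hb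
    ⟨(hs q hq).1.1, (hs q hq).1.2.1, (hs q hq).1.2.2.1, (hs q hq).1.2.2.2.1⟩
    ⟨(hs q' hq').1.1, (hs q' hq').1.2.1, (hs q' hq').1.2.2.1, (hs q' hq').1.2.2.2.1⟩ h) X
    (fun q hq i => by
      have := (aux_pt a b ha hb hab A hA T hT q (hs q hq).1 (hs q hq).2).2 i
      rw [hX, Nat.lt_add_one_iff]
      exact Nat.le_floor this)
  have hlogX : 1 + Real.log X ≤ C1 * Real.log T := by
    have hXle : (X : ℝ) ≤ 2 * K * T ^ (2 * A + 1) := by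
      rw [hX]; push_cast
      have := Nat.floor_le (show 0 ≤ K * T ^ (2 * A + 1) by positivity)
      nlinarith
    have h1 := Real.log_le_log (by rw [hX]; positivity) hXle
    rw [Real.log_mul (by positivity) (by positivity), Real.log_rpow hT0] at h1
    rw [hC1]
    nlinarith
  have hX0 : 0 ≤ 1 + Real.log X := by
    have : 0 ≤ Real.log X := Real.log_natCast_nonneg X
    linarith
  calc _ ≤ ∑ q ∈ s, (192 * (a + b) *
        T ^ (1 / ((a : ℝ) + b) - 1 / (((a : ℝ) + b) * ((a : ℝ) + b - 1))) *
        ((4 * A + 1) * Real.log T)) * ∏ i, (1 / ((auxPhi a b q i : ℝ) + 1)) :=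
        Finset.sum_le_sum fun q hq => (aux_pt a b ha hb hab A hA T hT q (hs q hq).1 (hs q hq).2).1
    _ = (192 * (a + b) *
        T ^ (1 / ((a : ℝ) + b) - 1 / (((a : ℝ) + b) * ((a : ℝ) + b - 1))) *
        ((4 * A + 1) * Real.log T)) * ∑ q ∈ s, ∏ i, (1 / ((auxPhi a b q i : ℝ) + 1)) := by
        rw [Finset.mul_sum]
    _ ≤ (192 * (a + b) *
        T ^ (1 / ((a : ℝ) + b) - 1 / (((a : ℝ) + b) * ((a : ℝ) + b - 1))) *
        ((4 * A + 1) * Real.log T)) * (C1 * Real.log T) ^ 7 := by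
        gcongr
        exact hbox.trans (pow_le_pow_left₀ hX0 hlogX 7)
    _ = _ := by ring

lemma aux_tm_swap (T a b h₁ h₂ r₁ r₂ : ℝ) :
    auxTm T a b h₁ h₂ r₁ r₂ = auxTm T b a r₁ r₂ h₁ h₂ := by
  unfold auxTm
  rw [add_comm b a, mul_comm (r₁ ^ b), mul_comm (r₂ ^ b), mul_comm ((r₁ * r₂) ^ _),
    add_comm b (2 * a), add_comm (2 * b) a]

lemma aux_full (a b : ℕ) (ha : 1 ≤ a) (hb : 1 ≤ b) (hab : 3 ≤ a + b) (A : ℝ) (hA : 0 < A) :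
    ∃ C > (0 : ℝ), ∀ T : ℝ, 10 ≤ T → ∀ s : Finset (ℕ × ℕ × ℕ × ℕ),
      (∀ q ∈ s, auxAdm a b (T ^ A) (T ^ A) q) →
      ∑ q ∈ s, auxTm T a b q.1 q.2.1 q.2.2.1 q.2.2.2 ≤
        C * T ^ (1 / ((a : ℝ) + b) - 1 / (((a : ℝ) + b) * ((a : ℝ) + b - 1))) *
          (Real.log T) ^ 8 := by
  classical
  obtain ⟨C1, hC1, H1⟩ := aux_core a b ha hb hab A hA
  obtain ⟨C2, hC2, H2⟩ := aux_core b a hb ha (by omega) A hA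
  refine ⟨C1 + C2, by positivity, fun T hT s hs => ?_⟩
  rw [← Finset.sum_filter_add_sum_filter_not s auxP]
  have h1 := H1 T hT (s.filter auxP) (fun q hq => by
    rw [Finset.mem_filter] at hq; exact ⟨hs q hq.1, hq.2⟩)
  let σ : ℕ × ℕ × ℕ × ℕ → ℕ × ℕ × ℕ × ℕ := fun q => (q.2.2.1, q.2.2.2, q.1, q.2.1)
  have hσ : Function.Injective σ := by
    rintro ⟨x, y, z, w⟩ ⟨x', y', z', w'⟩ h
    simp only [σ, Prod.mk.injEq] at h ⊢
    tauto
  have h2 := H2 T hT ((s.filter (fun q => ¬ auxP q)).image σ) (fun q hq => by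
    obtain ⟨p, hp, rfl⟩ := Finset.mem_image.1 hq
    rw [Finset.mem_filter] at hp
    obtain ⟨p1, p2, p3, p4, b1, b2, b3, b4, hne⟩ := hs p hp.1
    refine ⟨⟨p3, p4, p1, p2, b3, b4, b1, b2, ?_⟩, ?_⟩
    · simp only [σ]
      rw [mul_comm, mul_comm (p.2.2.2 ^ b)]; exact hne
    · have := hp.2
      simp only [auxP, σ, not_le] at this ⊢
      exact this.le)
  rw [Finset.sum_image hσ.injOn] at h2
  have e : ∑ q ∈ s.filter (fun q => ¬ auxP q), auxTm T a b q.1 q.2.1 q.2.2.1 q.2.2.2 =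
      ∑ q ∈ s.filter (fun q => ¬ auxP q),
        auxTm T b a (σ q).1 (σ q).2.1 (σ q).2.2.1 (σ q).2.2.2 :=
    Finset.sum_congr rfl fun q _ => aux_tm_swap _ _ _ _ _ _ _
  rw [e, add_mul, add_mul]
  rw [add_comm (b : ℝ) a] at h2
  exact add_le_add h1 h2

lemma aux_sigma (a b : ℕ) (ha : 1 ≤ a) (hb : 1 ≤ b) (hab : 3 ≤ a + b) (A : ℝ) (hA : 0 < A) :
    ∃ C > (0 : ℝ), ∀ T H R : ℝ, 10 ≤ T → H ≤ T ^ A → R ≤ T ^ A →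
      Sigma2 T H R a b ≤
        C * T ^ (1 / ((a : ℝ) + b) - 1 / (((a : ℝ) + b) * ((a : ℝ) + b - 1))) *
          (Real.log T) ^ 8 := by
  classical
  obtain ⟨C, hC, hfull⟩ := aux_full a b ha hb hab A hA
  refine ⟨C, hC, fun T H R hT hH hR => ?_⟩
  have hT0 : 0 < T := by linarith
  have hlog : 0 ≤ Real.log T := Real.log_nonneg (by linarith)
  let ι : ℕ+ × ℕ+ × ℕ+ × ℕ+ → ℕ × ℕ × ℕ × ℕ := fun q => (q.1, q.2.1, q.2.2.1, q.2.2.2)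
  have hι : Function.Injective ι := by
    rintro ⟨x, y, z, w⟩ ⟨x', y', z', w'⟩ h
    simpa only [ι, Prod.mk.injEq, PNat.coe_inj] using h
  have main : ∀ s' : Finset (ℕ+ × ℕ+ × ℕ+ × ℕ+), (∀ p ∈ s', (p.1 : ℝ) ≤ H ∧ (p.2.1 : ℝ) ≤ H ∧
      (p.2.2.1 : ℝ) ≤ R ∧ (p.2.2.2 : ℝ) ≤ R ∧ 0 < |etaFn a b p.1 p.2.2.1 p.2.1 p.2.2.2|) →
      ∑ p ∈ s', auxTm T a b (ι p).1 (ι p).2.1 (ι p).2.2.1 (ι p).2.2.2 ≤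
        C * T ^ (1 / ((a : ℝ) + b) - 1 / (((a : ℝ) + b) * ((a : ℝ) + b - 1))) *
          (Real.log T) ^ 8 := by
    intro s' hs'
    have h := hfull T hT (s'.image ι) (fun q hq => by
      obtain ⟨p, hp, rfl⟩ := Finset.mem_image.1 hq
      obtain ⟨b1, b2, b3, b4, hne⟩ := hs' p hp
      refine ⟨p.1.pos, p.2.1.pos, p.2.2.1.pos, p.2.2.2.pos, b1.trans hH, b2.trans hH, b3.trans hR,
        b4.trans hR, ?_⟩
      intro h
      simp only [ι] at h
      apply hne.ne'
      rw [abs_eq_zero, etaFn, sub_eq_zero]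
      congr 1
      simp only [Real.rpow_natCast]
      exact_mod_cast h)
    rwa [Finset.sum_image hι.injOn] at h
  unfold Sigma2
  apply tsum_le_of_sum_le' (by positivity)
  intro s
  rw [← Finset.sum_filter]
  refine main _ (fun p hp => ?_)
  obtain ⟨-, b1, b2, b3, b4, hne, -⟩ := Finset.mem_filter.1 hp
  exact ⟨b1, b2, b3, b4, hne⟩

theorem Sigma2_bound_coprime_integers (a b : ℕ) (ha : 1 ≤ a) (hab : a < b)
    (hcop : Nat.gcd a b = 1) (A : ℝ) (hA : 0 < A) :
    ∃ C > (0 : ℝ), ∀ T H R : ℝ, 10 ≤ T →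
      2 ≤ H → H ≤ T ^ A → 2 ≤ R → R ≤ T ^ A →
      Sigma2 T H R a b + Sigma2 T H R b a ≤
        C * T ^ (1 / ((a : ℝ) + b) -
          (a : ℝ) / (b * ((a : ℝ) + b) * ((a : ℝ) + b - 1))) * (Real.log T) ^ 4 := by
  obtain ⟨C1, hC1, H1⟩ := aux_sigma a b ha (by omega) (by omega) A hA
  obtain ⟨C2, hC2, H2⟩ := aux_sigma b a (by omega) ha (by omega) A hA
  have ha' : (1 : ℝ) ≤ a := by exact_mod_cast ha
  have hab' : (a : ℝ) + 1 ≤ b := by exact_mod_cast hab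
  have hb0 : (0 : ℝ) < b := by linarith
  have hc0 : (0 : ℝ) < (a : ℝ) + b := by linarith
  have hc1 : (0 : ℝ) < (a : ℝ) + b - 1 := by linarith
  set θ : ℝ := 1 / ((a : ℝ) + b) - 1 / (((a : ℝ) + b) * ((a : ℝ) + b - 1)) with hθ
  set θ' : ℝ := 1 / ((a : ℝ) + b) - (a : ℝ) / (b * ((a : ℝ) + b) * ((a : ℝ) + b - 1)) with hθ'
  have hlt : 0 < θ' - θ := by
    have : θ' - θ = ((b : ℝ) - a) / (b * ((a : ℝ) + b) * ((a : ℝ) + b - 1)) := by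
      rw [hθ, hθ']; field_simp; ring
    rw [this]
    apply div_pos (by linarith) (by positivity)
  set ε : ℝ := (θ' - θ) / 4 with hε
  have hε0 : 0 < ε := by positivity
  refine ⟨(C1 + C2) * (1 / ε) ^ 4, by positivity, fun T H R hT _ hH _ hR => ?_⟩
  have hT0 : 0 < T := by linarith
  have hlog : 0 ≤ Real.log T := Real.log_nonneg (by linarith)
  have h1 := H1 T H R hT hH hR
  have h2 := H2 T H R hT hH hR
  rw [add_comm (b : ℝ) a, ← hθ] at h2
  have hl : Real.log T ^ 4 ≤ (1 / ε) ^ 4 * T ^ (θ' - θ) := by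
    have h3 := pow_le_pow_left₀ hlog (Real.log_le_rpow_div hT0.le hε0) 4
    refine h3.trans (le_of_eq ?_)
    have e4 : ε * ((4 : ℕ) : ℝ) = θ' - θ := by rw [hε]; push_cast; ring
    rw [div_pow, ← Real.rpow_natCast (T ^ ε), ← Real.rpow_mul hT0.le, e4]
    ring
  calc _ ≤ (C1 + C2) * T ^ θ * Real.log T ^ 8 := by linarith
    _ = (C1 + C2) * T ^ θ * Real.log T ^ 4 * Real.log T ^ 4 := by ring
    _ ≤ (C1 + C2) * T ^ θ * ((1 / ε) ^ 4 * T ^ (θ' - θ)) * Real.log T ^ 4 := by gcongr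
    _ = (C1 + C2) * (1 / ε) ^ 4 * (T ^ θ * T ^ (θ' - θ)) * Real.log T ^ 4 := by ring
    _ = _ := by rw [← Real.rpow_add hT0]; congr 3; ring
end
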